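/- arXiv:2103.03952 — 2 statements merged into one kernel-verified Lean document; each statement's English description precedes it below -/
import Mathlib

section
/- For every integer n ≥ 0, the simplicial complex K = (S^0)^{*(n+1)}, the join of n+1 copies of the discrete complex on 2 vertices (the boundary of the (n+1)-dimensional cross-polytope), is a finite (2n+1)-conic simplicial complex whose geometric realization is homeomorphic to the n-sphere S^n; in particular K is (n−1)-connected but not n-connected, so for finite complexes (2n+1)-conicity does not imply n-connectivity. -/
open Finset
open scoped Classical

/-- An abstract simplicial complex on vertex type `V`: a downward-closed family of
nonempty finite subsets of `V`. -/
structure SComplex (V : Type*) where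
  faces : Set (Finset V)
  not_empty_mem : ∅ ∉ faces
  down_closed : ∀ {s t : Finset V}, s ∈ faces → t ⊆ s → t.Nonempty → t ∈ faces

namespace SComplex

variable {V W : Type*}

/-- The vertex set of a simplicial complex. -/
def vertexSet (K : SComplex V) : Set V := {v | {v} ∈ K.faces}

/-- The geometric realization of a simplicial complex, as the set of convex-combination
coordinate functions supported on a simplex. -/
def realization (K : SComplex V) : Set (V → ℝ) :=
  {x | ∃ σ ∈ K.faces, (∀ v, 0 ≤ x v) ∧ (∀ v, v ∉ σ → x v = 0) ∧ (∑ v ∈ σ, x v) = 1}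

/-- The geometric realization as a topological space. -/
abbrev space (K : SComplex V) : Type _ := ↥(K.realization)

/-- `L` is a subcomplex of `K`. -/
def IsSubcomplex (L K : SComplex V) : Prop := L.faces ⊆ K.faces

/-- A complex is `r`-conic (`r` an integer, possibly `-1`) if every subcomplex with at
most `r` vertices is contained in the closed star of some vertex. -/
def IsConic (K : SComplex V) (r : ℤ) : Prop :=
  ∀ L : SComplex V, L.IsSubcomplex K → L.vertexSet.Finite →
    (L.vertexSet.ncard : ℤ) ≤ r →
    ∃ v ∈ K.vertexSet, ∀ σ ∈ L.faces, insert v σ ∈ K.faces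

/-- The link of a vertex `v` in `K`. -/
def vertexLink (K : SComplex V) (v : V) : Set (Finset V) :=
  {τ ∈ K.faces | v ∉ τ ∧ insert v τ ∈ K.faces}

/-- A nonempty complex is `r`-ample if for every set `U` of at most `r` vertices and
every subcomplex `L` with vertices in `U`, some vertex `v` has a link whose simplices
contained in `U` are exactly those of `L`. -/
def IsAmple (K : SComplex V) (r : ℕ) : Prop :=
  K.faces.Nonempty ∧
  ∀ U : Finset V, ↑U ⊆ K.vertexSet → U.card ≤ r →
    ∀ L : SComplex V, L.IsSubcomplex K → L.vertexSet ⊆ ↑U →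
      ∃ v ∈ K.vertexSet, {τ ∈ K.vertexLink v | ↑τ ⊆ (U : Set V)} = L.faces

end SComplex

/-- A topological space is `n`-connected if it is nonempty and every continuous map
from the `k`-sphere, `0 ≤ k ≤ n`, is null-homotopic. -/
def NConnected (n : ℕ) (X : Type*) [TopologicalSpace X] : Prop :=
  Nonempty X ∧ ∀ k : ℕ, k ≤ n →
    ∀ f : C(Metric.sphere (0 : EuclideanSpace ℝ (Fin (k + 1))) 1, X),
      f.Nullhomotopic

/-- The boundary of the `(n+1)`-dimensional cross-polytope: the join of `n + 1` copies
of the discrete complex `S⁰` on two vertices.  Vertices are pairs `(i, ε)` with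
`i : Fin (n+1)`, `ε : Bool`, and simplices are the nonempty sets of vertices containing
no antipodal pair `(i, true), (i, false)`. -/
def crossPolytope (n : ℕ) : SComplex (Fin (n + 1) × Bool) where
  faces := {σ | σ.Nonempty ∧ ∀ i : Fin (n + 1), ¬ ((i, true) ∈ σ ∧ (i, false) ∈ σ)}
  not_empty_mem := by
    rintro ⟨h, -⟩
    exact Finset.not_nonempty_empty h
  down_closed := by
    rintro s t ⟨-, hs⟩ hts ht
    exact ⟨ht, fun i hi => hs i ⟨hts hi.1, hts hi.2⟩⟩

open Metric Module

section SphereMaps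

variable {E : Type*} [NormedAddCommGroup E] [NormedSpace ℝ E]

/-- Radial projection onto the unit sphere, sending `0` to a chosen point `e`. -/
noncomputable def radialProj (e : sphere (0 : E) 1) (x : E) : sphere (0 : E) 1 :=
  if h : x = 0 then e else ⟨‖x‖⁻¹ • x, by simp [norm_smul, h]⟩

theorem coe_radialProj (e : sphere (0 : E) 1) {x : E} (hx : x ≠ 0) :
    (radialProj e x : E) = ‖x‖⁻¹ • x := by
  simp [radialProj, hx]

theorem radialProj_coe (e x : sphere (0 : E) 1) : radialProj e (x : E) = x := by
  have hx : ‖(x : E)‖ = 1 := by simp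
  have h0 : (x : E) ≠ 0 := by
    intro h
    simp [h] at hx
  apply Subtype.ext
  rw [coe_radialProj e h0, hx, inv_one, one_smul]

theorem norm_smul_radialProj (e : sphere (0 : E) 1) (x : E) :
    ‖x‖ • (radialProj e x : E) = x := by
  by_cases hx : x = 0
  · simp [hx]
  · rw [coe_radialProj e hx, smul_inv_smul₀ (norm_ne_zero_iff.2 hx)]

theorem continuousOn_radialProj (e : sphere (0 : E) 1) :
    ContinuousOn (radialProj e) {0}ᶜ := by
  rw [Topology.IsInducing.subtypeVal.continuousOn_iff]
  have : ContinuousOn (fun x : E => ‖x‖⁻¹ • x) {0}ᶜ :=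
    (continuous_norm.continuousOn.inv₀ fun x hx => norm_ne_zero_iff.2 hx).smul continuousOn_id
  exact this.congr fun x hx => coe_radialProj e hx

/-- Two maps into a unit sphere that are nowhere antipodal are homotopic. -/
theorem homotopic_of_forall_ne_neg {X : Type*} [TopologicalSpace X]
    (f g : C(X, sphere (0 : E) 1)) (h : ∀ x, f x ≠ -g x) : f.Homotopic g := by
  rcases isEmpty_or_nonempty X with hX | ⟨⟨x₀⟩⟩
  · rw [show f = g from ContinuousMap.ext fun x => hX.elim x]
  let c : unitInterval × X → E := fun p => (1 - (p.1 : ℝ)) • (f p.2 : E) + (p.1 : ℝ) • (g p.2 : E)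
  have hc : Continuous c := by fun_prop
  have hc0 : ∀ p, c p ≠ 0 := by
    rintro ⟨t, x⟩ hp
    have h1 : (1 - (t : ℝ)) • (f x : E) = -((t : ℝ) • (g x : E)) := eq_neg_of_add_eq_zero_left hp
    have h2 := congrArg norm h1
    rw [norm_neg, norm_smul, norm_smul, Real.norm_of_nonneg t.2.1,
      Real.norm_of_nonneg (sub_nonneg.2 t.2.2), norm_eq_of_mem_sphere, norm_eq_of_mem_sphere,
      mul_one, mul_one] at h2
    have h3 : (t : ℝ) ≠ 0 := by linarith
    rw [h2, ← smul_neg] at h1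
    exact h x (Subtype.ext (smul_right_injective E h3 h1))
  refine ⟨⟨⟨fun p => radialProj (f x₀) (c p), ?_⟩, fun x => ?_, fun x => ?_⟩⟩
  · exact (continuousOn_radialProj _).comp_continuous hc hc0
  · simp [c, radialProj_coe]
  · simp [c, radialProj_coe]

end SphereMaps

section LowDim

variable {E F : Type*} [NormedAddCommGroup E] [InnerProductSpace ℝ E] [FiniteDimensional ℝ E]
  [NormedAddCommGroup F] [NormedSpace ℝ F] [FiniteDimensional ℝ F]

/-- The cone over the image of the unit sphere under a `C¹` map into a space of larger dimension
misses some nonzero vector. -/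
theorem exists_forall_smul_ne_of_finrank_lt {p : E → F} (hp : ContDiff ℝ 1 p)
    (hEF : finrank ℝ E < finrank ℝ F) :
    ∃ v : F, v ≠ 0 ∧ ∀ x : E, ‖x‖ = 1 → ∀ c : ℝ, 0 < c → c • p x ≠ v := by
  let C : E → F := fun y => ‖y‖ • p (‖y‖⁻¹ • y)
  have hC : ∀ y ∈ ({0}ᶜ : Set E), ContDiffAt ℝ 1 C y := fun y hy => by
    have hn : ContDiffAt ℝ 1 (fun y : E => ‖y‖) y := contDiffAt_norm ℝ hy
    exact hn.smul (hp.contDiffAt.comp y ((hn.inv (norm_ne_zero_iff.2 hy)).smul contDiffAt_id))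
  have hdim : dimH (C '' {0}ᶜ) < finrank ℝ F := by
    calc dimH (C '' {0}ᶜ) ≤ dimH ({0}ᶜ : Set E) :=
          dimH_image_le_of_locally_lipschitzOn fun y hy => by
            obtain ⟨K, t, ht, hK⟩ := (hC y hy).exists_lipschitzOnWith
            exact ⟨K, t, mem_nhdsWithin_of_mem_nhds ht, hK⟩
      _ ≤ dimH (Set.univ : Set E) := dimH_mono (Set.subset_univ _)
      _ = finrank ℝ E := Real.dimH_univ_eq_finrank E
      _ < finrank ℝ F := Nat.cast_lt.2 hEF
  have : Nontrivial F := Module.nontrivial_of_finrank_pos (R := ℝ) (by omega)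
  obtain ⟨u, hu⟩ := exists_ne (0 : F)
  obtain ⟨v, hv0, hv⟩ := (dense_compl_of_dimH_lt_finrank hdim).inter_open_nonempty {0}ᶜ
    isOpen_compl_singleton ⟨u, hu⟩
  refine ⟨v, hv0, fun x hx c hc hcv => hv ⟨c • x, ?_, ?_⟩⟩
  · have hx0 : x ≠ 0 := by
      rintro rfl
      simp at hx
    exact smul_ne_zero hc.ne' hx0
  · simp only [C]
    rw [norm_smul, hx, mul_one, Real.norm_of_nonneg hc.le, inv_smul_smul₀ hc.ne', hcv]

/-- A map from a sphere to a sphere of larger dimension is null-homotopic. -/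
theorem nullhomotopic_of_finrank_lt (hEF : finrank ℝ E < finrank ℝ F)
    (f : C(sphere (0 : E) 1, sphere (0 : F) 1)) : f.Nullhomotopic := by
  have : Nontrivial F := Module.nontrivial_of_finrank_pos (R := ℝ) (by omega)
  obtain ⟨u⟩ : Nonempty (sphere (0 : F) 1) :=
    (NormedSpace.sphere_nonempty.2 zero_le_one).to_subtype
  rcases isEmpty_or_nonempty (sphere (0 : E) 1) with hE | ⟨⟨e⟩⟩
  · exact ⟨u, by rw [show f = ContinuousMap.const _ u from ContinuousMap.ext fun x => hE.elim x]⟩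
  let G : E → F := fun x => ‖x‖ • (f (radialProj e x) : F)
  have hG : Continuous G := by
    rw [continuous_iff_continuousAt]
    intro x
    by_cases hx : x = 0
    · subst hx
      have h0 : G 0 = 0 := by simp [G]
      rw [ContinuousAt, h0]
      refine squeeze_zero_norm (fun x => ?_) (tendsto_norm_zero (E := E))
      simp [G, norm_smul]
    · have h1 : ContinuousAt (radialProj e) x :=
        (continuousOn_radialProj e).continuousAt (isOpen_compl_singleton.mem_nhds hx)
      have h2 : ContinuousAt (fun x => (f (radialProj e x) : F)) x :=
        (continuous_subtype_val.comp f.continuous).continuousAt.comp h1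
      exact continuous_norm.continuousAt.smul h2
  obtain ⟨p, hp, hpG, -⟩ := hG.exists_contDiff_approx 1 (continuous_const (y := (1 : ℝ)))
    (fun _ => one_pos)
  have hpf : ∀ x : sphere (0 : E) 1, ‖p x - f x‖ < 1 := fun x => by
    have := hpG x
    rwa [dist_eq_norm, show G x = f x by simp [G, radialProj_coe]] at this
  have hp0 : ∀ x : sphere (0 : E) 1, p x ≠ 0 := fun x hx => by
    have := hpf x
    simp [hx] at this
  let q : C(sphere (0 : E) 1, sphere (0 : F) 1) :=
    ⟨fun x => radialProj u (p x), (continuousOn_radialProj u).comp_continuous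
      (hp.continuous.comp continuous_subtype_val) hp0⟩
  have hfq : f.Homotopic q := by
    refine homotopic_of_forall_ne_neg f q fun x hx => ?_
    have h1 := norm_smul_radialProj u (p x)
    have h2 : (radialProj u (p x) : F) = -(f x : F) := by
      rw [hx]
      simp [q]
    have h3 : p x - f x = -((‖p x‖ + 1) • (f x : F)) := by
      conv_lhs => rw [← h1, h2]
      module
    have h4 := hpf x
    rw [h3, norm_neg, norm_smul, norm_eq_of_mem_sphere, mul_one,
      Real.norm_of_nonneg (by positivity)] at h4
    linarith [norm_nonneg (p x)]
  obtain ⟨v, hv0, hv⟩ := exists_forall_smul_ne_of_finrank_lt hp hEF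
  refine ⟨-radialProj u v, hfq.trans (homotopic_of_forall_ne_neg _ _ fun x hx => ?_)⟩
  have h1 : radialProj u (p x) = radialProj u v := by simpa [q] using hx
  have hpx := norm_pos_iff.2 (hp0 x)
  refine hv x (by simp) (‖v‖ / ‖p x‖) (div_pos (norm_pos_iff.2 hv0) hpx) ?_
  have h2 := norm_smul_radialProj u v
  rwa [← h1, coe_radialProj u (hp0 x), smul_smul, ← div_eq_mul_inv] at h2

end LowDim

section Perturbation

theorem bijective_id_add_of_lipschitzWith {E : Type*} [NormedAddCommGroup E] [CompleteSpace E]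
    {K : NNReal} (hK : K < 1) {g : E → E} (hg : LipschitzWith K g) :
    Function.Bijective fun x => x + g x := by
  have hc : ∀ y, ContractingWith K fun x => y - g x := fun y =>
    ⟨hK, LipschitzWith.of_dist_le_mul fun a b => by
      simpa only [dist_sub_left] using hg.dist_le_mul a b⟩
  refine ⟨fun a b hab => ?_, fun y => ?_⟩
  · have ha : Function.IsFixedPt (fun x => (b + g b) - g x) a := by
      simp only [Function.IsFixedPt]
      rw [← show a + g a = b + g b from hab, add_sub_cancel_right]
    have hb : Function.IsFixedPt (fun x => (b + g b) - g x) b := add_sub_cancel_right _ _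
    exact (hc _).fixedPoint_unique' ha hb
  · refine ⟨(hc y).fixedPoint, ?_⟩
    have := (hc y).fixedPoint_isFixedPt
    exact (eq_sub_iff_add_eq.1 this.symm)

variable {E : Type*} [NormedAddCommGroup E] [NormedSpace ℝ E]

/-- Extending by zero a function that is Lipschitz on the closed unit ball and vanishes on the
unit sphere gives a Lipschitz function. -/
theorem lipschitzWith_indicator_closedBall {F : Type*} [NormedAddCommGroup F] {K : NNReal}
    {g : E → F} (hg : LipschitzOnWith K g (closedBall 0 1)) (h0 : ∀ x, ‖x‖ = 1 → g x = 0) :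
    LipschitzWith K ((closedBall (0 : E) 1).indicator g) := by
  have key : ∀ x ∈ closedBall (0 : E) 1, ∀ y ∉ closedBall (0 : E) 1, ‖g x‖ ≤ K * ‖x - y‖ := by
    intro x hx y hy
    rw [mem_closedBall_zero_iff] at hx hy
    have hcont : ContinuousOn (fun s : ℝ => ‖x + s • (y - x)‖) (Set.Icc 0 1) := by fun_prop
    obtain ⟨s, ⟨hs0, hs1⟩, hs⟩ : (1 : ℝ) ∈ (fun s : ℝ => ‖x + s • (y - x)‖) '' Set.Icc 0 1 :=
      intermediate_value_Icc zero_le_one hcont ⟨by simpa using hx, by simpa using (not_le.1 hy).le⟩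
    have h1 := hg.dist_le_mul x (by simpa using hx) (x + s • (y - x)) (by simpa using hs.le)
    rw [dist_eq_norm, h0 _ hs, sub_zero, dist_eq_norm] at h1
    refine h1.trans (mul_le_mul_of_nonneg_left ?_ K.2)
    rw [show x - (x + s • (y - x)) = s • (x - y) by module, norm_smul, Real.norm_of_nonneg hs0]
    exact mul_le_of_le_one_left (norm_nonneg _) hs1
  refine LipschitzWith.of_dist_le_mul fun x y => ?_
  by_cases hx : x ∈ closedBall (0 : E) 1 <;> by_cases hy : y ∈ closedBall (0 : E) 1
  · simpa only [Set.indicator_of_mem hx, Set.indicator_of_mem hy] using hg.dist_le_mul x hx y hy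
  · simpa only [Set.indicator_of_mem hx, Set.indicator_of_notMem hy, dist_zero_right,
      dist_eq_norm x y] using key x hx y hy
  · simpa only [Set.indicator_of_mem hy, Set.indicator_of_notMem hx, dist_zero_left,
      dist_eq_norm' x y] using key y hy x hx
  · simp only [Set.indicator_of_notMem hx, Set.indicator_of_notMem hy, dist_self]
    positivity

/-- `det (1 + t A)` at `t = 1` is a combination of its values at `finrank E + 1` nodes, by Lagrange
interpolation. -/
theorem det_one_add_eq_sum_basis [FiniteDimensional ℝ E] {v : ℕ → ℝ} (hv : Function.Injective v)
    (A : E →L[ℝ] E) :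
    (1 + A).det = ∑ i ∈ range (finrank ℝ E + 1), ((1 + v i • A).det *
      (Lagrange.basis (range (finrank ℝ E + 1)) v i).eval 1) := by
  let b := Module.finBasis ℝ E
  let M := LinearMap.toMatrix b b (A : E →ₗ[ℝ] E)
  let p : Polynomial ℝ := Matrix.det ((Polynomial.X : Polynomial ℝ) • M.map Polynomial.C +
    (1 : Matrix _ _ ℝ).map Polynomial.C)
  have hp : ∀ t : ℝ, (1 + t • A).det = p.eval t := fun t => by
    rw [ContinuousLinearMap.det, ← LinearMap.det_toMatrix b, ← Polynomial.coe_evalRingHom,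
      RingHom.map_det]
    congr 1
    ext i j
    simp only [M, Matrix.one_apply, LinearMap.toMatrix_one, ContinuousLinearMap.toLinearMap_add,
      ContinuousLinearMap.toLinearMap_smul, ContinuousLinearMap.toLinearMap_one, map_add, map_smul,
      Matrix.add_apply, Matrix.smul_apply, Matrix.map_apply, RingHom.mapMatrix_apply,
      Polynomial.coe_evalRingHom, Polynomial.eval_mul, Polynomial.eval_C,
      Polynomial.eval_X, smul_eq_mul]
    ring
  have hdeg : p.degree < (range (finrank ℝ E + 1)).card := by
    refine Polynomial.degree_le_natDegree.trans_lt ?_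
    rw [card_range, Nat.cast_lt, Nat.lt_succ_iff]
    exact (Polynomial.natDegree_det_X_add_C_le M 1).trans_eq (by simp)
  have := congrArg (Polynomial.eval 1) (Lagrange.eq_interpolate (v := v) hv.injOn hdeg)
  rw [Lagrange.interpolate_apply, Polynomial.eval_finsetSum] at this
  simp_rw [hp]
  rw [← one_smul ℝ A, hp]
  simpa using this

end Perturbation

section SphereNotContractible

open MeasureTheory

variable {E : Type*} [NormedAddCommGroup E] [InnerProductSpace ℝ E] [FiniteDimensional ℝ E]

theorem det_fderiv_eq_zero_of_norm_eq_one {r : E → E} (hr : Differentiable ℝ r)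
    (h1 : ∀ x, ‖r x‖ = 1) (x : E) : (fderiv ℝ r x).det = 0 := by
  by_contra hdet
  have horth : ∀ v, inner ℝ (r x) (fderiv ℝ r x v) = 0 := fun v => by
    have h := ((hr x).hasFDerivAt.norm_sq)
    have h' : HasFDerivAt (fun y => ‖r y‖ ^ 2) (0 : E →L[ℝ] ℝ) x := by
      simpa [h1] using hasFDerivAt_const (1 : ℝ) x
    have := congrArg (fun L : E →L[ℝ] ℝ => L v) (h.unique h')
    simpa using this
  have hsurj : Function.Surjective (fderiv ℝ r x) :=
    (LinearMap.equivOfDetNeZero (fderiv ℝ r x : E →ₗ[ℝ] E) hdet).surjective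
  obtain ⟨v, hv⟩ := hsurj (r x)
  have := horth v
  rw [hv, real_inner_self_eq_norm_sq, h1] at this
  norm_num at this

/-- There is no `C¹` retraction of the unit ball onto the unit sphere. -/
theorem not_exists_contDiff_retraction {r : E → E} (hr : ContDiff ℝ 1 r) (h1 : ∀ x, ‖r x‖ = 1)
    (h2 : ∀ x, ‖x‖ = 1 → r x = x) : False := by
  borelize E
  let μ : Measure E := Measure.addHaar
  let A : E → E →L[ℝ] E := fun x => fderiv ℝ r x - 1
  have hA : Continuous A := (hr.continuous_fderiv one_ne_zero).sub continuous_const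
  have hrA : ∀ x, HasFDerivAt (fun y => r y - y) (A x) x := fun x =>
    (hr.differentiable one_ne_zero x).hasFDerivAt.sub (hasFDerivAt_id x)
  obtain ⟨K, hK⟩ : ∃ K, LipschitzOnWith K (fun x => r x - x) (closedBall (0 : E) 1) :=
    (hr.sub contDiff_id).contDiffOn.exists_lipschitzOnWith one_ne_zero (convex_closedBall _ _)
      (isCompact_closedBall _ _)
  let g : E → E := (closedBall (0 : E) 1).indicator fun x => r x - x
  have hg : LipschitzWith K g :=
    lipschitzWith_indicator_closedBall hK fun x hx => sub_eq_zero.2 (h2 x hx)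
  have hg0 : ∀ x, x ∉ ball (0 : E) 1 → g x = 0 := fun x hx => by
    by_cases hx' : x ∈ closedBall (0 : E) 1
    · rw [mem_closedBall_zero_iff] at hx'
      rw [mem_ball_zero_iff, not_lt] at hx
      simp only [g, Set.indicator_apply, h2 x (le_antisymm hx' hx), sub_self, ite_self]
    · exact Set.indicator_of_notMem hx' _
  obtain ⟨M, hM⟩ := (isCompact_closedBall (0 : E) 1).exists_bound_of_continuousOn hA.continuousOn
  have hdetc : Continuous fun B : E →L[ℝ] E => B.det := ContinuousLinearMap.continuous_det
  obtain ⟨δ, hδ, hδdet⟩ : ∃ δ > 0, ∀ B : E →L[ℝ] E, dist B 1 < δ → 0 < B.det := by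
    have : ∀ᶠ B in nhds (1 : E →L[ℝ] E), 0 < B.det :=
      hdetc.continuousAt.eventually (lt_mem_nhds (by simp [ContinuousLinearMap.det]))
    exact Metric.eventually_nhds_iff.1 this
  have hvol : ∀ t : ℝ, 0 ≤ t → t * K < 1 → t * M < δ →
      ∫ x in ball (0 : E) 1, (1 + t • A x).det ∂μ = μ.real (ball (0 : E) 1) := by
    intro t ht htK htM
    have htg : LipschitzWith (t.toNNReal * K) fun x => t • g x := by
      have := (lipschitzWith_smul t).comp hg
      rwa [show ‖t‖₊ = t.toNNReal by ext; simp [ht]] at this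
    have hbij : Function.Bijective fun x => x + t • g x :=
      bijective_id_add_of_lipschitzWith (by
        rw [← NNReal.coe_lt_coe]
        simpa [ht] using htK) htg
    have hfix : ∀ x, x ∉ ball (0 : E) 1 → x + t • g x = x := fun x hx => by simp [hg0 x hx]
    have himg : (fun x => x + t • g x) '' ball (0 : E) 1 = ball 0 1 := by
      ext y
      constructor
      · rintro ⟨x, hx, rfl⟩
        by_contra hy
        rw [hbij.1 (hfix _ hy)] at hy
        exact hy hx
      · intro hy
        obtain ⟨x, rfl⟩ := hbij.2 y
        by_contra hx
        refine hx ⟨x, ?_, rfl⟩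
        by_contra hx'
        simp only [hfix x hx'] at hy
        exact hx' hy
    have hder : ∀ x ∈ ball (0 : E) 1,
        HasFDerivWithinAt (fun x => x + t • g x) (1 + t • A x) (ball 0 1) x := fun x hx => by
      have h : HasFDerivAt (fun x => x + t • (r x - x)) (1 + t • A x) x :=
        (hasFDerivAt_id x).add ((hrA x).const_smul t)
      have hcongr : ∀ y ∈ ball (0 : E) 1, y + t • g y = y + t • (r y - y) := fun y hy => by
        simp only [g, Set.indicator_of_mem (ball_subset_closedBall hy)]
      exact h.hasFDerivWithinAt.congr hcongr (hcongr x hx)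
    have hcov := integral_image_eq_integral_abs_det_fderiv_smul μ measurableSet_ball hder
      hbij.1.injOn (fun _ => (1 : ℝ))
    rw [himg] at hcov
    rw [setIntegral_const, smul_eq_mul, mul_one] at hcov
    rw [hcov]
    refine setIntegral_congr_fun measurableSet_ball fun x hx => ?_
    have hpos : 0 < (1 + t • A x).det := by
      refine hδdet _ ?_
      rw [dist_eq_norm, add_sub_cancel_left, norm_smul, Real.norm_of_nonneg ht]
      exact (mul_le_mul_of_nonneg_left (hM x (ball_subset_closedBall hx)) ht).trans_lt htM
    simp [abs_of_pos hpos]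
  obtain ⟨ε, hε, hεK, hεM⟩ : ∃ ε : ℝ, 0 < ε ∧ ε * K < 1 ∧ ε * |M| < δ := by
    have hd : 0 < K + |M| + 1 := by positivity
    refine ⟨min 1 δ / (K + |M| + 1), by positivity, ?_, ?_⟩
    · rw [div_mul_eq_mul_div, div_lt_one hd]
      nlinarith [min_le_left 1 δ, K.2, abs_nonneg M, lt_min one_pos hδ]
    · rw [div_mul_eq_mul_div, div_lt_iff₀ hd]
      nlinarith [min_le_right 1 δ, K.2, abs_nonneg M, lt_min one_pos hδ,
        mul_nonneg hδ.le (show (0 : ℝ) ≤ K from K.2)]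
  let v : ℕ → ℝ := fun i => ε / (i + 1)
  have hv : Function.Injective v := fun i j hij => by
    have hi : (i : ℝ) + 1 ≠ 0 := by positivity
    have hj : (j : ℝ) + 1 ≠ 0 := by positivity
    simp only [v] at hij
    rw [div_eq_div_iff hi hj] at hij
    have := mul_left_cancel₀ hε.ne' hij
    exact_mod_cast (add_right_cancel this).symm
  have hvε : ∀ i, 0 ≤ v i ∧ v i ≤ ε := fun i =>
    ⟨by positivity, div_le_self hε.le (by linarith [(Nat.cast_nonneg i : (0 : ℝ) ≤ i)])⟩
  have hvvol : ∀ i, ∫ x in ball (0 : E) 1, (1 + v i • A x).det ∂μ = μ.real (ball (0 : E) 1) :=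
    fun i => hvol (v i) (hvε i).1
      ((mul_le_mul_of_nonneg_right (hvε i).2 K.2).trans_lt hεK)
      (((mul_le_mul_of_nonneg_left (le_abs_self M) (hvε i).1).trans
        (mul_le_mul_of_nonneg_right (hvε i).2 (abs_nonneg M))).trans_lt hεM)
  have hint : ∀ i, IntegrableOn (fun x => (1 + v i • A x).det) (ball (0 : E) 1) μ := fun i =>
    (ContinuousOn.integrableOn_compact (isCompact_closedBall (0 : E) 1)
      (hdetc.comp (continuous_const.add (hA.const_smul (v i)))).continuousOn).mono_set
      ball_subset_closedBall
  have hzero : ∫ x in ball (0 : E) 1, (1 + A x).det ∂μ = 0 := by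
    have : ∀ x, (1 + A x).det = 0 := fun x => by
      simp only [A, add_sub_cancel]
      exact det_fderiv_eq_zero_of_norm_eq_one (hr.differentiable one_ne_zero) h1 x
    simp [this]
  rw [setIntegral_congr_fun measurableSet_ball fun x _ => det_one_add_eq_sum_basis hv (A x),
    integral_finsetSum _ fun i _ => (hint i).mul_const _] at hzero
  simp_rw [integral_mul_const, hvvol] at hzero
  rw [← Finset.mul_sum, ← Polynomial.eval_finsetSum,
    Lagrange.sum_basis hv.injOn (by simp), Polynomial.eval_one, mul_one] at hzero
  exact (ENNReal.toReal_pos (measure_ball_pos μ 0 one_pos).ne' measure_ball_lt_top.ne).ne' hzero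

/-- The identity of the unit sphere is not null-homotopic. -/
theorem not_nullhomotopic_id_sphere :
    ¬ (ContinuousMap.id (sphere (0 : E) 1)).Nullhomotopic := by
  rintro ⟨e, ⟨H⟩⟩
  let τ : E → unitInterval := fun x => Set.projIcc 0 1 zero_le_one (2 - 2 * ‖x‖)
  have hτ : Continuous τ := continuous_projIcc.comp (by fun_prop)
  let F : E → E := fun x => H (τ x, radialProj e x)
  have hF1 : ∀ x, ‖F x‖ = 1 := fun x => norm_eq_of_mem_sphere _
  have hFin : ∀ x ∈ ball (0 : E) (1 / 2), F x = e := fun x hx => by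
    rw [mem_ball_zero_iff] at hx
    have : τ x = 1 := Set.projIcc_of_right_le _ (by linarith)
    simp [F, this]
  have hFout : ∀ x : E, 1 ≤ ‖x‖ → F x = ‖x‖⁻¹ • x := fun x hx => by
    have : τ x = 0 := Set.projIcc_of_le_left _ (by linarith)
    have hx0 : x ≠ 0 := norm_pos_iff.1 (by linarith)
    simp [F, this, coe_radialProj e hx0]
  have hF : Continuous F := by
    rw [continuous_iff_continuousAt]
    intro x
    by_cases hx : x = 0
    · subst hx
      refine (continuousAt_const (y := (e : E))).congr ?_
      filter_upwards [ball_mem_nhds (0 : E) (by norm_num : (0 : ℝ) < 1 / 2)] with y hy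
      exact (hFin y hy).symm
    · have h1 : ContinuousAt (radialProj e) x :=
        (continuousOn_radialProj e).continuousAt (isOpen_compl_singleton.mem_nhds hx)
      exact (continuous_subtype_val.comp H.continuous).continuousAt.comp
        (hτ.continuousAt.prodMk h1)
  have hnorm : ∀ x : E, x ≠ 0 → ContDiffAt ℝ 1 (fun y : E => ‖y‖⁻¹ • y) x := fun x hx =>
    ((contDiffAt_norm ℝ hx).inv (norm_ne_zero_iff.2 hx)).smul contDiffAt_id
  have hopen : IsOpen {x : E | 1 < ‖x‖} := isOpen_lt continuous_const continuous_norm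
  have hFsmooth : ContDiffOn ℝ 1 F {x : E | 1 < ‖x‖} := by
    have : ContDiffOn ℝ 1 (fun y : E => ‖y‖⁻¹ • y) {x : E | 1 < ‖x‖} := fun x hx =>
      (hnorm x (norm_pos_iff.1 (one_pos.trans hx))).contDiffWithinAt
    exact this.congr fun x hx => hFout x (le_of_lt hx)
  have hclosed : IsClosed {x : E | 2 ≤ ‖x‖} := isClosed_le continuous_const continuous_norm
  obtain ⟨p, hp, hpF, hpeq, -⟩ := hF.exists_contDiff_approx_and_eqOn 1
    (continuous_const (y := (1 : ℝ))) (fun _ => one_pos) hclosed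
    (hopen.mem_nhdsSet.2 fun x (hx : 2 ≤ ‖x‖) => show 1 < ‖x‖ by linarith) hFsmooth
  have hp0 : ∀ x, p x ≠ 0 := fun x hx => by
    have := hpF x
    rw [hx, dist_zero_left, hF1] at this
    exact lt_irrefl _ this
  refine not_exists_contDiff_retraction (r := fun x => ‖p ((2 : ℝ) • x)‖⁻¹ • p ((2 : ℝ) • x))
    ?_ (fun x => ?_) fun x hx => ?_
  · rw [contDiff_iff_contDiffAt]
    intro x
    exact (hnorm _ (hp0 _)).comp (f := fun x : E => p ((2 : ℝ) • x)) x
      (hp.comp (contDiff_const_smul (2 : ℝ))).contDiffAt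
  · simp [norm_smul, hp0]
  · have h2 : ‖(2 : ℝ) • x‖ = 2 := by simp [norm_smul, hx]
    have h3 : p ((2 : ℝ) • x) = x := by
      rw [hpeq (show 2 ≤ ‖(2 : ℝ) • x‖ from h2.ge), hFout _ (by rw [h2]; norm_num), h2,
        inv_smul_smul₀ two_ne_zero]
    simp only [h3, hx, inv_one, one_smul]

end SphereNotContractible

section CrossPolytope

variable {n : ℕ}

theorem crossPolytope_faces_finite (n : ℕ) : (crossPolytope n).faces.Finite :=
  Set.toFinite _

theorem crossPolytope_isConic (n : ℕ) : (crossPolytope n).IsConic (2 * n + 1) := by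
  intro L hL _ hcard
  obtain ⟨⟨i, b⟩, hib⟩ : ∃ v, v ∉ L.vertexSet := by
    by_contra! h
    have hu : L.vertexSet = Set.univ := Set.eq_univ_of_forall h
    rw [hu, Set.ncard_univ, Nat.card_eq_fintype_card, Fintype.card_prod, Fintype.card_fin,
      Fintype.card_bool] at hcard
    push_cast at hcard
    linarith
  refine ⟨(i, !b), ⟨Finset.singleton_nonempty _, fun j => by simp; grind⟩, fun σ hσ => ?_⟩
  refine ⟨by simp, fun j hj => ?_⟩
  have hσib : (i, b) ∉ σ := fun h =>
    hib (L.down_closed hσ (Finset.singleton_subset_iff.2 h) (Finset.singleton_nonempty _))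
  have hσj := (hL hσ).2 j
  simp only [Finset.mem_insert, Prod.mk.injEq] at hj
  cases b <;> grind

theorem mem_crossPolytope_realization {x : Fin (n + 1) × Bool → ℝ} :
    x ∈ (crossPolytope n).realization ↔
      (∀ v, 0 ≤ x v) ∧ (∀ i, x (i, true) = 0 ∨ x (i, false) = 0) ∧ ∑ v, x v = 1 := by
  constructor
  · rintro ⟨σ, ⟨-, hσ⟩, h0, hout, hsum⟩
    refine ⟨h0, fun i => ?_, ?_⟩
    · by_cases h : (i, true) ∈ σ
      · exact Or.inr (hout _ fun h' => hσ i ⟨h, h'⟩)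
      · exact Or.inl (hout _ h)
    · rw [← hsum]
      exact (Finset.sum_subset (Finset.subset_univ σ) fun v _ hv => hout v hv).symm
  · rintro ⟨h0, hor, hsum⟩
    refine ⟨univ.filter fun v => x v ≠ 0, ⟨?_, fun i hi => ?_⟩, h0, fun v hv => ?_, ?_⟩
    · rw [Finset.nonempty_iff_ne_empty]
      intro h
      rw [← Finset.sum_filter_ne_zero, h] at hsum
      simp at hsum
    · simp only [mem_filter, mem_univ, true_and] at hi
      exact (hor i).elim hi.1 hi.2
    · simpa using hv
    · rw [Finset.sum_filter_ne_zero, hsum]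

/-- The linear map sending the vertices `(i, true)` and `(i, false)` to the `i`-th standard basis
vector and its opposite. -/
noncomputable def crossDiff (x : Fin (n + 1) × Bool → ℝ) : EuclideanSpace ℝ (Fin (n + 1)) :=
  WithLp.toLp 2 fun i => x (i, true) - x (i, false)

/-- Positive and negative parts of the coordinates. -/
noncomputable def crossParts (y : EuclideanSpace ℝ (Fin (n + 1))) (v : Fin (n + 1) × Bool) : ℝ :=
  if v.2 then max (y v.1) 0 else max (-y v.1) 0

theorem continuous_crossDiff : Continuous (crossDiff (n := n)) := by
  unfold crossDiff
  fun_prop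

theorem continuous_crossParts : Continuous (crossParts (n := n)) := by
  refine continuous_pi fun ⟨i, b⟩ => ?_
  cases b <;> simp only [crossParts, if_true, Bool.false_eq_true, if_false] <;> fun_prop

theorem crossDiff_smul (c : ℝ) (x : Fin (n + 1) × Bool → ℝ) :
    crossDiff (c • x) = c • crossDiff x := by
  ext i
  simp [crossDiff, mul_sub]

theorem crossParts_smul {c : ℝ} (hc : 0 ≤ c) (y : EuclideanSpace ℝ (Fin (n + 1))) :
    crossParts (c • y) = c • crossParts y := by
  ext ⟨i, b⟩
  cases b <;> simp [crossParts, mul_max_of_nonneg _ _ hc]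

theorem crossDiff_crossParts (y : EuclideanSpace ℝ (Fin (n + 1))) :
    crossDiff (crossParts y) = y := by
  ext i
  simp only [crossDiff, crossParts]
  rcases le_total (y i) 0 with h | h <;> simp [h]

theorem crossParts_crossDiff {x : Fin (n + 1) × Bool → ℝ}
    (hx : x ∈ (crossPolytope n).realization) : crossParts (crossDiff x) = x := by
  obtain ⟨h0, hor, -⟩ := mem_crossPolytope_realization.1 hx
  ext ⟨i, b⟩
  have ht := h0 (i, true)
  have hf := h0 (i, false)
  rcases hor i with h | h <;> cases b <;> simp [crossParts, crossDiff, h, ht, hf]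

theorem crossParts_nonneg (y : EuclideanSpace ℝ (Fin (n + 1))) (v : Fin (n + 1) × Bool) :
    0 ≤ crossParts y v := by
  unfold crossParts
  split_ifs <;> exact le_max_right _ _

theorem sum_crossParts_pos {y : EuclideanSpace ℝ (Fin (n + 1))} (hy : y ≠ 0) :
    0 < ∑ v, crossParts y v := by
  refine (Finset.sum_nonneg fun v _ => crossParts_nonneg y v).lt_of_ne' fun h => hy ?_
  rw [Finset.sum_eq_zero_iff_of_nonneg fun v _ => crossParts_nonneg y v] at h
  rw [← crossDiff_crossParts y]
  ext i
  simp [crossDiff, h]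

theorem inv_sum_smul_crossParts_mem {y : EuclideanSpace ℝ (Fin (n + 1))} (hy : y ≠ 0) :
    (∑ v, crossParts y v)⁻¹ • crossParts y ∈ (crossPolytope n).realization := by
  have hpos := sum_crossParts_pos hy
  refine mem_crossPolytope_realization.2 ⟨fun v => ?_, fun i => ?_, ?_⟩
  · exact mul_nonneg (inv_nonneg.2 hpos.le) (crossParts_nonneg y v)
  · rcases le_total (y i) 0 with h | h
    · exact Or.inl (by simp [crossParts, h])
    · exact Or.inr (by simp [crossParts, h])
  · simp only [Pi.smul_apply, smul_eq_mul]
    rw [← Finset.mul_sum, inv_mul_cancel₀ hpos.ne']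

theorem crossDiff_ne_zero {x : Fin (n + 1) × Bool → ℝ}
    (hx : x ∈ (crossPolytope n).realization) : crossDiff x ≠ 0 := by
  intro h
  have hx1 := (mem_crossPolytope_realization.1 hx).2.2
  rw [← crossParts_crossDiff hx, h] at hx1
  simp [crossParts] at hx1

/-- The boundary of the cross-polytope is homeomorphic to the unit sphere by radial projection. -/
noncomputable def crossPolytopeHomeomorph (e : sphere (0 : EuclideanSpace ℝ (Fin (n + 1))) 1) :
    (crossPolytope n).space ≃ₜ sphere (0 : EuclideanSpace ℝ (Fin (n + 1))) 1 where
  toFun x := radialProj e (crossDiff x)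
  invFun y := ⟨(∑ v, crossParts (y : EuclideanSpace ℝ (Fin (n + 1))) v)⁻¹ •
      crossParts (y : EuclideanSpace ℝ (Fin (n + 1))),
    inv_sum_smul_crossParts_mem (y := (y : EuclideanSpace ℝ (Fin (n + 1))))
      (ne_zero_of_mem_unit_sphere y)⟩
  left_inv x := by
    have hx := x.2
    have hc : 0 < ‖crossDiff (x : Fin (n + 1) × Bool → ℝ)‖⁻¹ :=
      inv_pos.2 (norm_pos_iff.2 (crossDiff_ne_zero hx))
    apply Subtype.ext
    change (∑ v, crossParts (radialProj e (crossDiff x) : EuclideanSpace ℝ (Fin (n + 1))) v)⁻¹ •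
      crossParts (radialProj e (crossDiff x) : EuclideanSpace ℝ (Fin (n + 1))) = x
    rw [coe_radialProj e (crossDiff_ne_zero hx), crossParts_smul hc.le, crossParts_crossDiff hx]
    simp only [Pi.smul_apply, smul_eq_mul]
    rw [← Finset.mul_sum, (mem_crossPolytope_realization.1 hx).2.2, mul_one,
      inv_smul_smul₀ hc.ne']
  right_inv y := by
    have hpos := sum_crossParts_pos (ne_zero_of_mem_unit_sphere y)
    have h : crossDiff ((∑ v, crossParts (y : EuclideanSpace ℝ (Fin (n + 1))) v)⁻¹ •
        crossParts (y : EuclideanSpace ℝ (Fin (n + 1)))) ≠ 0 := by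
      rw [crossDiff_smul, crossDiff_crossParts]
      exact smul_ne_zero (inv_ne_zero hpos.ne') (ne_zero_of_mem_unit_sphere y)
    apply Subtype.ext
    rw [coe_radialProj e h, crossDiff_smul, crossDiff_crossParts, norm_smul, norm_eq_of_mem_sphere, mul_one,
      Real.norm_of_nonneg (inv_nonneg.2 hpos.le), inv_smul_smul₀ (inv_ne_zero hpos.ne')]
  continuous_toFun := (continuousOn_radialProj e).comp_continuous
    (continuous_crossDiff.comp continuous_subtype_val) fun x => crossDiff_ne_zero x.2
  continuous_invFun := by
    have hP : Continuous fun y : sphere (0 : EuclideanSpace ℝ (Fin (n + 1))) 1 =>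
        crossParts (y : EuclideanSpace ℝ (Fin (n + 1))) :=
      continuous_crossParts.comp continuous_subtype_val
    have hS : Continuous fun y : sphere (0 : EuclideanSpace ℝ (Fin (n + 1))) 1 =>
        ∑ v, crossParts (y : EuclideanSpace ℝ (Fin (n + 1))) v :=
      continuous_finsetSum _ fun v _ => (continuous_apply v).comp hP
    exact Continuous.subtype_mk ((hS.inv₀ fun y =>
      (sum_crossParts_pos (ne_zero_of_mem_unit_sphere y)).ne').smul hP) _

end CrossPolytope

theorem NConnected.of_homeomorph {X Y : Type*} [TopologicalSpace X] [TopologicalSpace Y] {n : ℕ}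
    (h : X ≃ₜ Y) (hX : NConnected n X) : NConnected n Y := by
  refine ⟨hX.1.map h, fun k hk f => ?_⟩
  have := (hX.2 k hk ((h.symm : C(Y, X)).comp f)).comp_right (h : C(X, Y))
  rwa [← ContinuousMap.comp_assoc, Homeomorph.toContinuousMap_comp_symm,
    ContinuousMap.id_comp] at this

/-- For every `n ≥ 0` the complex `(S⁰)^{*(n+1)}` (the boundary of the
`(n+1)`-dimensional cross-polytope) is a finite `(2n+1)`-conic complex whose geometric
realization is homeomorphic to `Sⁿ`; in particular it is `(n-1)`-connected but not
`n`-connected, so `(2n+1)`-conicity does not imply `n`-connectivity. -/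
theorem crossPolytope_conic_not_nconnected (n : ℕ) :
    (crossPolytope n).faces.Finite ∧
    (crossPolytope n).IsConic (2 * n + 1) ∧
    Nonempty ((crossPolytope n).space ≃ₜ
      Metric.sphere (0 : EuclideanSpace ℝ (Fin (n + 1))) 1) ∧
    Nonempty (crossPolytope n).space ∧
    (1 ≤ n → NConnected (n - 1) (crossPolytope n).space) ∧
    ¬ NConnected n (crossPolytope n).space := by
  obtain ⟨e⟩ : Nonempty (sphere (0 : EuclideanSpace ℝ (Fin (n + 1))) 1) :=
    (NormedSpace.sphere_nonempty.2 zero_le_one).to_subtype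
  let h := crossPolytopeHomeomorph e
  refine ⟨crossPolytope_faces_finite n, crossPolytope_isConic n, ⟨h⟩, ⟨h.symm e⟩,
    fun hn => NConnected.of_homeomorph h.symm ⟨⟨e⟩, fun k hk f => ?_⟩, fun hcon => ?_⟩
  · exact nullhomotopic_of_finrank_lt (by simp; omega) f
  · exact not_nullhomotopic_id_sphere ((hcon.of_homeomorph h).2 n le_rfl (ContinuousMap.id _))
end

section
/- Let n ≥ 1 and k ≥ 0 be integers. Let C_k be the cubical complex subdividing I^n into 2^{nk} cubes of side 2^{−k}, let C_k' be its barycentric subdivision, and let L_k be the simplicial complex obtained by gluing two copies of C_k' along their common boundary, so that L_k is a triangulation of the n-sphere S^n. Then L_{k+1} 6^n-stars to L_k: there is a finite sequence of 6^n-starrings transforming L_{k+1} into a complex isomorphic to L_k. -/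
open Finset
open scoped Classical

namespace SComplex

variable {V W : Type*}

/-- The affine extension of a vertex assignment `φ : W → (V → ℝ)` to barycentric
coordinate functions. -/
noncomputable def affMap (φ : W → V → ℝ) (x : W → ℝ) : V → ℝ :=
  fun v => ∑ᶠ w, x w * φ w v

/-- The closed geometric simplex of `K` spanned by the vertices of `σ`. -/
def geomSimplex (K : SComplex V) (σ : Finset V) : Set (V → ℝ) :=
  {x ∈ K.realization | ∀ v, v ∉ σ → x v = 0}

/-- `L` is a (geometric) subdivision of `K` via the vertex placement `φ`: the affine
extension of `φ` maps `|L|` bijectively onto `|K|` and maps each closed simplex of `L`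
into a closed simplex of `K`. -/
def IsSubdivisionVia (L : SComplex W) (φ : W → V → ℝ) (K : SComplex V) : Prop :=
  Set.BijOn (affMap φ) L.realization K.realization ∧
  ∀ σ ∈ L.faces, ∃ τ ∈ K.faces, affMap φ '' L.geomSimplex σ ⊆ K.geomSimplex τ

/-- `f` realizes a simplicial isomorphism from `K` onto `L`. -/
def IsIsoMap (f : V → W) (K : SComplex V) (L : SComplex W) : Prop :=
  Set.InjOn f K.vertexSet ∧
  (∀ σ ∈ K.faces, σ.image f ∈ L.faces) ∧
  (∀ τ ∈ L.faces, ∃ σ ∈ K.faces, σ.image f = τ)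

/-- Two simplicial complexes are isomorphic. -/
def Iso (K : SComplex V) (L : SComplex W) : Prop :=
  ∃ f : V → W, IsIsoMap f K L

/-- Two simplicial complexes are PL homeomorphic if they admit simplicially isomorphic
subdivisions. -/
def PLHomeo (K : SComplex V) (L : SComplex W) : Prop :=
  ∃ (A B : Type) (K' : SComplex A) (L' : SComplex B)
    (φ : A → V → ℝ) (ψ : B → W → ℝ),
      IsSubdivisionVia K' φ K ∧ IsSubdivisionVia L' ψ L ∧ Iso K' L'

end SComplex

/-- The standard `n`-simplex as a simplicial complex: all nonempty subsets of
`Fin (n+1)`. -/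
def stdSimplexC (n : ℕ) : SComplex (Fin (n + 1)) where
  faces := {σ | σ.Nonempty}
  not_empty_mem := by simp [Set.mem_setOf_eq]
  down_closed := fun _ _ h => h

/-- The boundary of the standard simplex on `Fin j`: all nonempty proper subsets.
For `j = m + 2` this is the combinatorial `m`-sphere `∂Δ^{m+1}`; for `j = 1` it is the
empty complex (the `(-1)`-sphere). -/
def boundaryC (j : ℕ) : SComplex (Fin j) where
  faces := {σ | σ.Nonempty ∧ σ ≠ Finset.univ}
  not_empty_mem := by
    rintro ⟨h, -⟩; exact Finset.not_nonempty_empty h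
  down_closed := by
    rintro s t ⟨-, hs⟩ hts ht
    refine ⟨ht, fun h => hs ?_⟩
    subst h
    exact Finset.univ_subset_iff.mp hts

namespace SComplex

variable {V : Type*}

/-- A combinatorial `d`-ball: a complex PL homeomorphic to the standard `d`-simplex. -/
def IsCombBall (d : ℕ) (K : SComplex V) : Prop := K.PLHomeo (stdSimplexC d)

/-- A complex PL homeomorphic to `∂Δ^{j-1}`, i.e. a combinatorial `(j-2)`-sphere. -/
def IsCombSphereAux (j : ℕ) (K : SComplex V) : Prop := K.PLHomeo (boundaryC j)

/-- The link of a simplex `σ` in `K`, as a simplicial complex. -/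
def linkC (K : SComplex V) (σ : Finset V) : SComplex V where
  faces := {τ | τ ∈ K.faces ∧ (∀ v ∈ σ, v ∉ τ) ∧ τ ∪ σ ∈ K.faces}
  not_empty_mem := fun h => K.not_empty_mem h.1
  down_closed := by
    rintro s t ⟨hs, hdisj, huni⟩ hts ht
    refine ⟨K.down_closed hs hts ht, fun v hv hvt => hdisj v hv (hts hvt), ?_⟩
    refine K.down_closed huni (Finset.union_subset_union_left hts) ?_
    exact ht.mono Finset.subset_union_left

/-- A combinatorial (PL) `n`-manifold: the link of every simplex `σ` is a combinatorial
sphere of dimension `n - dim σ - 1` (PL homeomorphic to the boundary of the standard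
`(n - dim σ)`-simplex). -/
def IsCombManifold (n : ℕ) (M : SComplex V) : Prop :=
  M.faces.Nonempty ∧
  ∀ σ ∈ M.faces, (M.linkC σ).IsCombSphereAux (n + 2 - σ.card)

/-- `(D, bD)` is a triangulated `d`-disk: there is a homeomorphism from `|D|` to the
closed unit `d`-ball carrying `|bD|` exactly onto the boundary sphere. -/
def IsTriangulatedDisk (D bD : SComplex V) (d : ℕ) : Prop :=
  bD.IsSubcomplex D ∧
  ∃ e : D.space ≃ₜ (Metric.closedBall (0 : EuclideanSpace ℝ (Fin d)) 1),
    ∀ x : D.space, (x : V → ℝ) ∈ bD.realization ↔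
      ((e x : EuclideanSpace ℝ (Fin d)) ∈
        Metric.sphere (0 : EuclideanSpace ℝ (Fin d)) 1)

/-- The faces of the cone with apex `w` over the family of faces `F`. -/
def coneFaces (w : V) (F : Set (Finset V)) : Set (Finset V) :=
  F ∪ (insert w '' F) ∪ {{w}}

/-- `Mt` is obtained from `M` by starring the triangulated `d`-disk `D` (with boundary
`bD`) at the new vertex `w`: all simplices of `D` not in `bD` are removed and the cone
`w ∂D` is attached. -/
def IsStarringAt (r : ℤ) (M Mt : SComplex V) (D bD : SComplex V) (d : ℕ) (w : V) :
    Prop :=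
  D.IsSubcomplex M ∧
  D.vertexSet.Finite ∧ (D.vertexSet.ncard : ℤ) ≤ r ∧
  IsTriangulatedDisk D bD d ∧
  (∀ σ ∈ M.faces, ∀ τ ∈ D.faces, τ ∉ bD.faces → τ ⊆ σ → σ ∈ D.faces) ∧
  w ∉ M.vertexSet ∧
  Mt.faces = (M.faces \ {τ | τ ∈ D.faces ∧ τ ∉ bD.faces}) ∪ coneFaces w bD.faces

/-- `Mt` is obtained from `M` by an `r`-starring. -/
def IsStarring (r : ℤ) (M Mt : SComplex V) : Prop :=
  ∃ (D bD : SComplex V) (d : ℕ) (w : V), IsStarringAt r M Mt D bD d w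

/-- `M` `r`-stars to `L`: `L` is obtained from `M` by a finite sequence of
`r`-starrings. -/
def StarsTo (r : ℤ) : SComplex V → SComplex V → Prop :=
  Relation.ReflTransGen (IsStarring r)

end SComplex

/-- A (possibly degenerate) cube of the grid subdivision of `Iⁿ`: in coordinate `i`,
`(j, true)` denotes the interval `[j, j+1]` (in grid units) and `(j, false)` denotes
the point `{j}`. -/
def GridCube (n : ℕ) : Type := Fin n → ℕ × Bool

/-- The cube `c` is a valid cube of the grid subdividing `Iⁿ` into
`m 0 × m 1 × ⋯ × m (n-1)` boxes. -/
def ValidCube {n : ℕ} (m : Fin n → ℕ) (c : GridCube n) : Prop :=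
  ∀ i, ((c i).2 = true → (c i).1 < m i) ∧ ((c i).2 = false → (c i).1 ≤ m i)

/-- `c` is a face of the cube `c'`. -/
def CubeFace {n : ℕ} (c c' : GridCube n) : Prop :=
  ∀ i, ((c' i).2 = true →
          (c i = c' i ∨ ((c i).2 = false ∧
            ((c i).1 = (c' i).1 ∨ (c i).1 = (c' i).1 + 1)))) ∧
       ((c' i).2 = false → c i = c' i)

/-- The barycentric subdivision of the cubical complex subdividing `Iⁿ` into
`m 0 × ⋯ × m (n-1)` boxes: vertices are the (valid) cubes of the grid and simplices are
the nonempty chains of cubes, each a face of the next. -/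
def baryGrid (n : ℕ) (m : Fin n → ℕ) : SComplex (GridCube n) where
  faces := {σ | σ.Nonempty ∧ (∀ c ∈ σ, ValidCube m c) ∧
    ∀ c ∈ σ, ∀ c' ∈ σ, CubeFace c c' ∨ CubeFace c' c}
  not_empty_mem := by
    rintro ⟨h, -⟩; exact Finset.not_nonempty_empty h
  down_closed := by
    rintro s t ⟨-, hval, hchain⟩ hts ht
    exact ⟨ht, fun c hc => hval c (hts hc),
      fun c hc c' hc' => hchain c (hts hc) c' (hts hc')⟩

/-- A cube of the `2^k`-grid on `Iⁿ` lies in the boundary `∂Iⁿ`. -/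
def OnBdry {n : ℕ} (k : ℕ) (c : GridCube n) : Prop :=
  ∃ i, (c i).2 = false ∧ ((c i).1 = 0 ∨ (c i).1 = 2 ^ k)

/-- Face relation between cubes of the double (two copies of the subdivided `Iⁿ` glued
along their boundaries, boundary cubes carrying the tag `false`). -/
def DoubleCubeFace {n : ℕ} (k : ℕ) (p q : GridCube n × Bool) : Prop :=
  CubeFace p.1 q.1 ∧ (p.2 = q.2 ∨ OnBdry k p.1)

/-- The triangulation `L_k` of `Sⁿ`: the barycentric subdivision of the cubical complex
obtained by gluing two copies of the `2^k`-grid subdivision of `Iⁿ` along their common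
boundary.  A vertex is a (valid) grid cube with a tag selecting the copy, boundary
cubes being shared (tag `false`); simplices are nonempty chains of cubes. -/
def sphereGrid (n k : ℕ) : SComplex (GridCube n × Bool) where
  faces := {σ | σ.Nonempty ∧
    (∀ p ∈ σ, ValidCube (fun _ => 2 ^ k) p.1 ∧ (OnBdry k p.1 → p.2 = false)) ∧
    ∀ p ∈ σ, ∀ q ∈ σ, DoubleCubeFace k p q ∨ DoubleCubeFace k q p}
  not_empty_mem := by
    rintro ⟨h, -⟩; exact Finset.not_nonempty_empty h
  down_closed := by
    rintro s t ⟨-, hval, hchain⟩ hts ht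
    exact ⟨ht, fun p hp => hval p (hts hp),
      fun p hp q hq => hchain p (hts hp) q (hts hq)⟩

/-! ### Order complexes -/

namespace SComplex

/-- The order complex of a subset `S` of a partial order: its simplices are the nonempty
finite chains contained in `S`. -/
def orderC {V : Type*} [PartialOrder V] (S : Set V) : SComplex V where
  faces := {σ | σ.Nonempty ∧ ↑σ ⊆ S ∧ IsChain (· ≤ ·) (σ : Set V)}
  not_empty_mem := fun h => Finset.not_nonempty_empty h.1
  down_closed := fun ⟨_, hS, hc⟩ hts ht =>
    ⟨ht, (Finset.coe_subset.mpr hts).trans hS, hc.mono (Finset.coe_subset.mpr hts)⟩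

section OrderComplex

variable {V : Type*} [PartialOrder V]

lemma vertexSet_orderC (S : Set V) : (orderC S).vertexSet = S := by
  ext v
  simp [vertexSet, orderC]

lemma mem_realization_orderC [Fintype V] {S : Set V} {x : V → ℝ} :
    x ∈ (orderC S).realization ↔ (∀ v, 0 ≤ x v) ∧ (∀ v, x v ≠ 0 → v ∈ S) ∧
      IsChain (· ≤ ·) (Function.support x) ∧ ∑ v, x v = 1 := by
  constructor
  · rintro ⟨σ, ⟨-, hS, hc⟩, h0, hz, hsum⟩
    have hsup : ∀ v, x v ≠ 0 → v ∈ σ := fun v hv => by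
      by_contra h
      exact hv (hz v h)
    refine ⟨h0, fun v hv => hS (hsup v hv), hc.mono fun v hv => hsup v hv, ?_⟩
    rw [← hsum]
    exact (Finset.sum_subset (Finset.subset_univ σ) fun v _ hv => hz v hv).symm
  · rintro ⟨h0, hS, hc, hsum⟩
    have hsum' : ∑ v ∈ Finset.univ.filter (fun v => x v ≠ 0), x v = 1 := by
      rw [← hsum, Finset.sum_filter_ne_zero]
    refine ⟨Finset.univ.filter fun v => x v ≠ 0, ⟨?_, ?_, ?_⟩, h0, ?_, hsum'⟩
    · by_contra h
      rw [Finset.not_nonempty_iff_eq_empty] at h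
      rw [h] at hsum'
      simp at hsum'
    · intro v hv
      exact hS v (by simpa using hv)
    · refine hc.mono fun v hv => ?_
      simpa using hv
    · intro v hv
      simpa using hv

/-- Starring an order complex: elements of `S_D \ S_B` are replaced by `w`. -/
lemma isStarringAt_orderC {S S' SD SB : Set V} {w : V} {r : ℤ} {d : ℕ}
    (hD : SD ⊆ S) (hfin : SD.Finite) (hr : (SD.ncard : ℤ) ≤ r)
    (hdisk : IsTriangulatedDisk (orderC SD) (orderC SB) d)
    (hco : ∀ a ∈ S, ∀ b ∈ SD, b ∉ SB → (a ≤ b ∨ b ≤ a) → a ∈ SD)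
    (hw : w ∉ S) (hBD : SB ⊆ SD) (hS' : S' = insert w (S \ (SD \ SB)))
    (hcw : ∀ a ∈ S \ (SD \ SB), (a ≤ w ∨ w ≤ a) ↔ a ∈ SB) :
    IsStarringAt r (orderC S) (orderC S') (orderC SD) (orderC SB) d w := by
  refine ⟨fun σ hσ => ⟨hσ.1, hσ.2.1.trans hD, hσ.2.2⟩, ?_, ?_, hdisk, ?_, ?_, ?_⟩
  · rwa [vertexSet_orderC]
  · rwa [vertexSet_orderC]
  · rintro σ ⟨hne, hσ, hc⟩ τ ⟨hτne, hτ, hτc⟩ hτB hsub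
    have : ∃ b ∈ τ, b ∉ SB := by
      by_contra! h
      exact hτB ⟨hτne, h, hτc⟩
    obtain ⟨b, hb, hbB⟩ := this
    exact ⟨hne, fun a ha => hco a (hσ ha) b (hτ hb) hbB (hc.total ha (hsub hb)), hc⟩
  · rwa [vertexSet_orderC]
  · have key : ∀ σ : Finset V, w ∉ σ → (σ ∈ (orderC S').faces ↔
        σ ∈ (orderC S).faces ∧ ¬ (σ ∈ (orderC SD).faces ∧ σ ∉ (orderC SB).faces)) := by
      intro σ hwσ
      constructor
      · rintro ⟨hne, hσ, hc⟩
        have hσ' : ∀ a ∈ σ, a ∈ S \ (SD \ SB) := by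
          intro a ha
          have := hσ ha
          rw [hS'] at this
          rcases this with rfl | h
          · exact absurd ha hwσ
          · exact h
        refine ⟨⟨hne, fun a ha => (hσ' a ha).1, hc⟩, fun h => h.2 ⟨hne, fun a ha => ?_, hc⟩⟩
        by_contra hB
        exact (hσ' a ha).2 ⟨h.1.2.1 ha, hB⟩
      · rintro ⟨⟨hne, hσ, hc⟩, h⟩
        refine ⟨hne, fun a ha => ?_, hc⟩
        rw [hS']
        refine Or.inr ⟨hσ ha, fun hab => h ⟨⟨hne, fun b hb => ?_, hc⟩, fun hB => hab.2 (hB.2.1 ha)⟩⟩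
        exact hco b (hσ hb) a hab.1 hab.2 (hc.total hb ha)
    have hwB : w ∉ SB := fun h => hw (hD (hBD h))
    ext σ
    by_cases hwσ : w ∈ σ
    · constructor
      · rintro ⟨hne, hσ, hc⟩
        right
        by_cases hone : σ = {w}
        · right; exact hone
        · left; right
          refine ⟨σ.erase w, ⟨?_, ?_, ?_⟩, Finset.insert_erase hwσ⟩
          · rw [Finset.nonempty_iff_ne_empty]
            intro h
            apply hone
            rw [← Finset.insert_erase hwσ, h]
            rfl
          · intro a ha
            rw [Finset.coe_erase] at ha
            have := hσ ha.1
            rw [hS'] at this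
            rcases this with rfl | h
            · exact absurd rfl ha.2
            · exact (hcw a h).1 (hc.total ha.1 hwσ)
          · exact hc.mono (Finset.coe_subset.mpr (Finset.erase_subset _ _))
      · rintro (⟨⟨-, hσ, -⟩, -⟩ | (hB | ⟨τ, ⟨hne, hτ, hc⟩, rfl⟩) | rfl)
        · exact absurd (hσ hwσ) hw
        · exact absurd (hB.2.1 hwσ) hwB
        · refine ⟨Finset.insert_nonempty _ _, ?_, ?_⟩
          · intro a ha
            rw [Finset.coe_insert] at ha
            rw [hS']
            rcases ha with rfl | ha
            · exact Or.inl rfl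
            · exact Or.inr ⟨hD (hBD (hτ ha)), fun h => h.2 (hτ ha)⟩
          · rw [Finset.coe_insert]
            refine hc.insert fun b hb _ => ?_
            have := (hcw b ⟨hD (hBD (hτ hb)), fun h => h.2 (hτ hb)⟩).2 (hτ hb)
            exact this.symm
        · refine ⟨Finset.singleton_nonempty _, ?_, by simp⟩
          rw [hS']
          simp
    · rw [key σ hwσ]
      constructor
      · rintro h
        exact Or.inl h
      · rintro (h | (hB | ⟨τ, -, rfl⟩) | rfl)
        · exact h
        · exact ⟨⟨hB.1, hB.2.1.trans (hBD.trans hD), hB.2.2⟩, fun h => h.2 hB⟩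
        · simp at hwσ
        · simp at hwσ

end OrderComplex

end SComplex

namespace SComplex

section Disk

variable {V : Type*} [Fintype V]

lemma isCompact_realization (K : SComplex V) : IsCompact K.realization := by
  have hcl : IsClosed K.realization := by
    have : K.realization = ⋃ σ ∈ K.faces,
        {x : V → ℝ | (∀ v, 0 ≤ x v) ∧ (∀ v, v ∉ σ → x v = 0) ∧ (∑ v ∈ σ, x v) = 1} := by
      ext x
      simp only [realization, Set.mem_iUnion, exists_prop]
      rfl
    rw [this]
    refine (Set.toFinite K.faces).isClosed_biUnion fun σ _ => ?_
    refine IsClosed.inter ?_ (IsClosed.inter ?_ ?_)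
    · have : IsClosed {x : V → ℝ | ∀ v, 0 ≤ x v} := by
        simp only [Set.ofPred_forall]
        exact isClosed_iInter fun v => isClosed_le continuous_const (continuous_apply v)
      exact this
    · have : IsClosed {x : V → ℝ | ∀ v, v ∉ σ → x v = 0} := by
        simp only [Set.ofPred_forall]
        exact isClosed_iInter fun v => isClosed_iInter fun _ =>
          isClosed_eq (continuous_apply v) continuous_const
      exact this
    · have : IsClosed {x : V → ℝ | (∑ v ∈ σ, x v) = 1} :=
        isClosed_eq (by fun_prop) continuous_const
      exact this
  refine IsCompact.of_isClosed_subset (isCompact_Icc (a := (0 : V → ℝ)) (b := 1)) hcl ?_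
  rintro x ⟨σ, -, h0, hz, hs⟩
  refine ⟨fun v => h0 v, fun v => ?_⟩
  by_cases hv : v ∈ σ
  · rw [Pi.one_apply, ← hs]
    exact Finset.single_le_sum (f := x) (fun a _ => h0 a) hv
  · rw [hz v hv]
    exact zero_le_one

/-- A compact body in Euclidean space cut out by a sublinear gauge `G` is a disk with
boundary `{G = 1}`. -/
lemma exists_homeomorph_closedBall_of_sublinear {n : ℕ}
    {G : EuclideanSpace ℝ (Fin n) → ℝ} (hG : Continuous G)
    (hadd : ∀ y z, G (y + z) ≤ G y + G z) (hsmul : ∀ c : ℝ, 0 ≤ c → ∀ z, G (c • z) = c * G z)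
    {C : ℝ} (hbound : ∀ z, ‖z‖ ≤ C * G z) :
    ∃ h : EuclideanSpace ℝ (Fin n) ≃ₜ EuclideanSpace ℝ (Fin n),
      h '' {z | G z ≤ 1} = Metric.closedBall 0 1 ∧ h '' {z | G z = 1} = Metric.sphere 0 1 := by
  have hG0 : G 0 = 0 := by simpa using hsmul 0 le_rfl 0
  have hcl : IsClosed {z | G z ≤ 1} := isClosed_le hG continuous_const
  have hconv : Convex ℝ {z | G z ≤ 1} := by
    intro y hy z hz a b ha hb hab
    have hy' : G y ≤ 1 := hy
    have hz' : G z ≤ 1 := hz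
    calc G (a • y + b • z) ≤ a * G y + b * G z := by
          rw [← hsmul a ha, ← hsmul b hb]
          exact hadd _ _
      _ ≤ a * 1 + b * 1 := by gcongr
      _ = 1 := by linarith
  have hlt : {z | G z < 1} ⊆ interior {z | G z ≤ 1} :=
    interior_maximal (fun z (hz : G z < 1) => hz.le) (isOpen_lt hG continuous_const)
  have h_integral : interior {z | G z ≤ 1} = {z | G z < 1} := by
    refine Set.Subset.antisymm (fun z hz => ?_) hlt
    have hz1 : G z ≤ 1 := (interior_subset hz : z ∈ {z | G z ≤ 1})
    refine lt_of_le_of_ne hz1 fun hz1 => ?_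
    have hlim : Filter.Tendsto (fun t : ℝ => t • z) (nhdsWithin 1 (Set.Ioi 1)) (nhds z) := by
      have : Filter.Tendsto (fun t : ℝ => t • z) (nhds 1) (nhds ((1 : ℝ) • z)) :=
        (continuous_id.smul continuous_const).tendsto 1
      rw [one_smul] at this
      exact this.mono_left nhdsWithin_le_nhds
    have hev := hlim.eventually (mem_interior_iff_mem_nhds.mp hz)
    obtain ⟨t, ht, ht1⟩ := (hev.and self_mem_nhdsWithin).exists
    have ht' : G (t • z) ≤ 1 := ht
    have ht1' : (1 : ℝ) < t := ht1
    rw [hsmul t (by linarith), hz1] at ht'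
    linarith
  have hb : Bornology.IsBounded {z | G z ≤ 1} := by
    refine (Metric.isBounded_iff_subset_closedBall 0).2 ⟨|C|, fun z hz => ?_⟩
    rw [mem_closedBall_zero_iff]
    have hz' : G z ≤ 1 := hz
    have hnn : 0 ≤ G z := by
      by_contra! h
      have h1 := hadd z ((-1 : ℝ) • z)
      have h2 := hbound z
      have h3 := hbound ((-1 : ℝ) • z)
      simp only [neg_smul, one_smul, add_neg_cancel, hG0, norm_neg] at h1 h3
      have h4 := norm_nonneg z
      by_cases hC : 0 < C
      · nlinarith
      · have : z = 0 := by
          have : ‖z‖ ≤ 0 := by nlinarith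
          simpa using this
        rw [this, hG0] at h
        exact lt_irrefl _ h
    calc ‖z‖ ≤ C * G z := hbound z
      _ ≤ |C| * G z := by gcongr; exact le_abs_self C
      _ ≤ |C| * 1 := by gcongr
      _ = |C| := mul_one _
  obtain ⟨h, -, h2, h3⟩ := exists_homeomorph_image_interior_closure_frontier_eq_unitBall hconv
    ⟨0, hlt (by simp [hG0])⟩ hb
  rw [hcl.closure_eq] at h2
  refine ⟨h, h2, ?_⟩
  rw [← h3, frontier, hcl.closure_eq, h_integral]
  congr 1
  ext z
  simp only [Set.mem_ofPred_eq, Set.mem_sdiff, not_lt]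
  exact ⟨fun h => ⟨h.le, h.ge⟩, fun h => le_antisymm h.1 h.2⟩

/-- A complex placed bijectively (and affinely on simplices) onto a body with sublinear
gauge `G`, with `bD` corresponding to `{G = 1}`, is a triangulated disk. -/
lemma isTriangulatedDisk_of_bijOn {D bD : SComplex V} (hsub : bD.IsSubcomplex D) {n : ℕ}
    (vec : V → Fin n → ℝ) {G : (Fin n → ℝ) → ℝ} (hG : Continuous G)
    (hadd : ∀ y z, G (y + z) ≤ G y + G z) (hsmul : ∀ c : ℝ, 0 ≤ c → ∀ z, G (c • z) = c * G z)
    {C : ℝ} (hbound : ∀ z, ‖z‖ ≤ C * G z)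
    (hbij : Set.BijOn (fun (x : V → ℝ) i => ∑ v, x v * vec v i) D.realization {z | G z ≤ 1})
    (hbd : ∀ x ∈ D.realization,
      x ∈ bD.realization ↔ G (fun i => ∑ v, x v * vec v i) = 1) :
    IsTriangulatedDisk D bD n := by
  refine ⟨hsub, ?_⟩
  let ι := EuclideanSpace.equiv (Fin n) ℝ
  have hC : ∀ z, ‖z‖ ≤ (‖(ι.symm : (Fin n → ℝ) →L[ℝ] EuclideanSpace ℝ (Fin n))‖ * C) * G (ι z) := by
    intro z
    calc ‖z‖ = ‖(ι.symm : (Fin n → ℝ) →L[ℝ] EuclideanSpace ℝ (Fin n)) (ι z)‖ := by simp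
      _ ≤ ‖(ι.symm : (Fin n → ℝ) →L[ℝ] EuclideanSpace ℝ (Fin n))‖ * ‖ι z‖ :=
        ContinuousLinearMap.le_opNorm _ _
      _ ≤ _ := by
        rw [mul_assoc]
        gcongr
        exact hbound _
  obtain ⟨h, h1, h2⟩ := exists_homeomorph_closedBall_of_sublinear (G := fun z => G (ι z))
    (hG.comp ι.continuous) (fun y z => by simpa using hadd (ι y) (ι z))
    (fun c hc z => by simpa using hsmul c hc (ι z)) hC
  let Φ : (V → ℝ) → Fin n → ℝ := fun x i => ∑ v, x v * vec v i
  have hΦ : Continuous Φ := by fun_prop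
  have hmem : ∀ x : D.space, h (ι.symm (Φ x)) ∈ Metric.closedBall (0 : EuclideanSpace ℝ (Fin n)) 1 := by
    intro x
    rw [← h1]
    exact ⟨_, by simpa using hbij.mapsTo x.2, rfl⟩
  let e : D.space → Metric.closedBall (0 : EuclideanSpace ℝ (Fin n)) 1 := fun x => ⟨_, hmem x⟩
  have he : Continuous e :=
    Continuous.subtype_mk (h.continuous.comp (ι.symm.continuous.comp (hΦ.comp continuous_subtype_val))) _
  have hinj : Function.Injective e := by
    intro x y hxy
    have := congrArg Subtype.val hxy
    exact Subtype.ext (hbij.injOn x.2 y.2 (ι.symm.injective (h.injective this)))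
  have hsurj : Function.Surjective e := by
    rintro ⟨y, hy⟩
    rw [← h1] at hy
    obtain ⟨z, hz, rfl⟩ := hy
    obtain ⟨x, hx, hxz⟩ := hbij.surjOn hz
    refine ⟨⟨x, hx⟩, Subtype.ext ?_⟩
    change h (ι.symm (Φ x)) = h z
    rw [show Φ x = ι z from hxz]
    simp
  have : CompactSpace D.space := isCompact_iff_compactSpace.mp (isCompact_realization D)
  refine ⟨he.homeoOfEquivCompactToT2 (f := Equiv.ofBijective e ⟨hinj, hsurj⟩), fun x => ?_⟩
  change _ ↔ h (ι.symm (Φ x)) ∈ _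
  rw [hbd x x.2, ← h2, h.injective.mem_set_image]
  change _ ↔ G (ι (ι.symm (Φ x))) = 1
  simp [Φ]

end Disk

end SComplex

section WeightedSum

variable {V : Type*} [Fintype V]

/-- The pairing of a weight function with a function on vertices. -/
def wsum (x g : V → ℝ) : ℝ := ∑ v, x v * g v

lemma wsum_congr {x g h : V → ℝ} (H : ∀ v, x v ≠ 0 → g v = h v) : wsum x g = wsum x h := by
  refine Finset.sum_congr rfl fun v _ => ?_
  by_cases hv : x v = 0
  · simp [hv]
  · rw [H v hv]

lemma wsum_mono {x g h : V → ℝ} (h0 : ∀ v, 0 ≤ x v) (H : ∀ v, x v ≠ 0 → g v ≤ h v) :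
    wsum x g ≤ wsum x h := by
  refine Finset.sum_le_sum fun v _ => ?_
  by_cases hv : x v = 0
  · simp [hv]
  · exact mul_le_mul_of_nonneg_left (H v hv) (h0 v)

lemma wsum_add (x g h : V → ℝ) : wsum x (fun v => g v + h v) = wsum x g + wsum x h := by
  simp [wsum, mul_add, Finset.sum_add_distrib]

lemma wsum_sub (x g h : V → ℝ) : wsum x (fun v => g v - h v) = wsum x g - wsum x h := by
  simp [wsum, mul_sub, Finset.sum_sub_distrib]

lemma wsum_const_mul (x g : V → ℝ) (c : ℝ) : wsum x (fun v => c * g v) = c * wsum x g := by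
  simp only [wsum, Finset.mul_sum]
  exact Finset.sum_congr rfl fun v _ => by ring

lemma wsum_zero (x : V → ℝ) : wsum x (fun _ => 0) = 0 := by simp [wsum]

lemma wsum_neg (x g : V → ℝ) : wsum x (fun v => -g v) = -wsum x g := by
  simp [wsum]

lemma wsum_nonneg {x g : V → ℝ} (h0 : ∀ v, 0 ≤ x v) (H : ∀ v, x v ≠ 0 → 0 ≤ g v) :
    0 ≤ wsum x g := by
  rw [← wsum_zero x]
  exact wsum_mono h0 H

/-- The total weight of a set of vertices. -/
noncomputable def mass (x : V → ℝ) (C : Set V) : ℝ := wsum x (C.indicator 1)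

lemma mass_nonneg {x : V → ℝ} (h0 : ∀ v, 0 ≤ x v) (C : Set V) : 0 ≤ mass x C :=
  wsum_nonneg h0 fun v _ => Set.indicator_nonneg (fun _ _ => zero_le_one) v

lemma mass_mono {x : V → ℝ} (h0 : ∀ v, 0 ≤ x v) {C C' : Set V}
    (H : ∀ v, x v ≠ 0 → v ∈ C → v ∈ C') : mass x C ≤ mass x C' := by
  refine wsum_mono h0 fun v hv => ?_
  by_cases h : v ∈ C
  · simp [h, H v hv h]
  · rw [Set.indicator_of_notMem h]
    exact Set.indicator_nonneg (fun _ _ => zero_le_one) v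

lemma mass_congr {x : V → ℝ} {C C' : Set V}
    (H : ∀ v, x v ≠ 0 → (v ∈ C ↔ v ∈ C')) : mass x C = mass x C' := by
  refine wsum_congr fun v hv => ?_
  by_cases h : v ∈ C
  · simp [h, (H v hv).1 h]
  · rw [Set.indicator_of_notMem h, Set.indicator_of_notMem fun h' => h ((H v hv).2 h')]

lemma mass_eq_zero {x : V → ℝ} {C : Set V} (H : ∀ v, x v ≠ 0 → v ∉ C) : mass x C = 0 := by
  rw [← wsum_zero x]
  exact wsum_congr fun v hv => by simp [H v hv]

lemma mass_univ (x : V → ℝ) : mass x Set.univ = ∑ v, x v := by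
  simp [mass, wsum]

lemma mass_pos {x : V → ℝ} (h0 : ∀ v, 0 ≤ x v) {C : Set V} {v : V} (hv : x v ≠ 0) (hC : v ∈ C) :
    0 < mass x C := by
  refine lt_of_lt_of_le (lt_of_le_of_ne (h0 v) hv.symm) ?_
  have : x v * C.indicator 1 v ≤ mass x C :=
    Finset.single_le_sum (f := fun v => x v * C.indicator (1 : V → ℝ) v)
      (fun a _ => mul_nonneg (h0 a) (Set.indicator_nonneg (fun _ _ => zero_le_one) a))
      (Finset.mem_univ v)
  simpa [hC] using this

lemma mass_union_of_disjoint (x : V → ℝ) {C C' : Set V} (h : Disjoint C C') :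
    mass x (C ∪ C') = mass x C + mass x C' := by
  rw [mass, Set.indicator_union_of_disjoint h, mass, mass, ← wsum_add]

end WeightedSum

namespace SComplex

section Placement

variable {V : Type*} [PartialOrder V] [Fintype V]

lemma exists_top_of_isChain {A : Set V} (hA : A.Nonempty) (hc : IsChain (· ≤ ·) A) :
    ∃ a ∈ A, ∀ b ∈ A, b ≤ a := by
  obtain ⟨a, ha⟩ := A.toFinite.exists_maximal hA
  refine ⟨a, ha.1, fun b hb => ?_⟩
  rcases hc.total ha.1 hb with h | h
  · exact ha.2 hb h
  · exact h

lemma exists_bot_of_isChain {A : Set V} (hA : A.Nonempty) (hc : IsChain (· ≤ ·) A) :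
    ∃ a ∈ A, ∀ b ∈ A, a ≤ b := by
  obtain ⟨a, ha⟩ := A.toFinite.exists_minimal hA
  refine ⟨a, ha.1, fun b hb => ?_⟩
  rcases hc.total ha.1 hb with h | h
  · exact h
  · exact ha.2 hb h

lemma mass_Ici_le {S : Set V} {x y : V → ℝ} (hx : x ∈ (orderC S).realization)
    (hy : y ∈ (orderC S).realization) {v : V} (𝒞 : Set (Set V))
    (hup : ∀ C ∈ 𝒞, ∀ a ∈ S, ∀ b ∈ S, a ∈ C → a ≤ b → b ∈ C)
    (hinter : ∀ a ∈ S, v ≤ a ↔ ∀ C ∈ 𝒞, a ∈ C)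
    (hmass : ∀ C ∈ 𝒞, mass x C = mass y C) : mass x (Set.Ici v) ≤ mass y (Set.Ici v) := by
  rw [mem_realization_orderC] at hx hy
  obtain ⟨hx0, hxS, -, hx1⟩ := hx
  obtain ⟨hy0, hyS, hyc, hy1⟩ := hy
  by_cases hall : ∀ a, y a ≠ 0 → v ≤ a
  · calc mass x (Set.Ici v) ≤ mass x Set.univ := mass_mono hx0 fun _ _ _ => trivial
      _ = mass y Set.univ := by rw [mass_univ, mass_univ, hx1, hy1]
      _ ≤ mass y (Set.Ici v) := mass_mono hy0 fun a ha _ => hall a ha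
  · push Not at hall
    obtain ⟨a, ha, hmax⟩ := exists_top_of_isChain (A := {a | y a ≠ 0 ∧ ¬ v ≤ a}) hall
      (hyc.mono fun a ha => ha.1)
    have : ∃ C ∈ 𝒞, a ∉ C := by
      by_contra! h
      exact ha.2 ((hinter a (hyS a ha.1)).2 h)
    obtain ⟨C, hC, haC⟩ := this
    calc mass x (Set.Ici v) ≤ mass x C :=
          mass_mono hx0 fun b hb hvb => (hinter b (hxS b hb)).1 hvb C hC
      _ = mass y C := hmass C hC
      _ ≤ mass y (Set.Ici v) := mass_mono hy0 fun b hb hbC => by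
          by_contra hvb
          exact haC (hup C hC b (hyS b hb) a (hyS a ha.1) hbC (hmax b ⟨hb, hvb⟩))

/-- A point of an order complex is determined by the masses of a family of up-sets
cutting out all principal up-sets. -/
lemma eq_of_mass_eq {S : Set V} {x y : V → ℝ} (hx : x ∈ (orderC S).realization)
    (hy : y ∈ (orderC S).realization)
    (h𝒞 : ∀ v ∈ S, ∃ 𝒞 : Set (Set V),
      (∀ C ∈ 𝒞, ∀ a ∈ S, ∀ b ∈ S, a ∈ C → a ≤ b → b ∈ C) ∧
      (∀ a ∈ S, v ≤ a ↔ ∀ C ∈ 𝒞, a ∈ C) ∧ ∀ C ∈ 𝒞, mass x C = mass y C) : x = y := by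
  have hIci : ∀ v ∈ S, mass x (Set.Ici v) = mass y (Set.Ici v) := by
    intro v hv
    obtain ⟨𝒞, h1, h2, h3⟩ := h𝒞 v hv
    exact le_antisymm (mass_Ici_le hx hy 𝒞 h1 h2 h3)
      (mass_Ici_le hy hx 𝒞 h1 h2 fun C hC => (h3 C hC).symm)
  by_contra hne
  obtain ⟨v, hv⟩ := Function.ne_iff.mp hne
  obtain ⟨a, ha⟩ := (Set.toFinite {v | x v ≠ y v}).exists_maximal ⟨v, hv⟩
  have haS : a ∈ S := by
    rw [mem_realization_orderC] at hx hy
    by_contra h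
    have h1 : x a = 0 := by_contra fun h' => h (hx.2.1 a h')
    have h2 : y a = 0 := by_contra fun h' => h (hy.2.1 a h')
    exact ha.1 (by rw [h1, h2])
  have hsplit : ∀ z : V → ℝ, mass z (Set.Ici a) = z a + mass z (Set.Ioi a) := by
    intro z
    have : mass z {a} = z a := by
      simp [mass, wsum, Set.indicator_apply]
    rw [← this, ← mass_union_of_disjoint]
    · congr 1
      ext b
      simp [le_iff_eq_or_lt]
    · simp
  have hIoi : mass x (Set.Ioi a) = mass y (Set.Ioi a) := by
    refine Finset.sum_congr rfl fun b _ => ?_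
    by_cases hb : a < b
    · have : x b = y b := by
        by_contra h
        exact hb.not_ge (ha.2 h hb.le)
      rw [this]
    · simp [hb]
  have := hIci a haS
  rw [hsplit, hsplit, hIoi] at this
  exact ha.1 (by linarith)

/-- A monotone path in `S` over the unit interval yields a point of the order complex:
the weight of a vertex is the length of time spent there. -/
lemma exists_realization_of_path {S : Set V} (γ : ℝ → V)
    (hS : ∀ t ∈ Set.Ico (0 : ℝ) 1, γ t ∈ S) (hγ : MonotoneOn γ (Set.Ico 0 1)) :
    ∃ x ∈ (orderC S).realization, ∀ g : V → ℝ,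
      wsum x g = ∫ t in Set.Ico (0 : ℝ) 1, g (γ t) := by
  let A : V → Set ℝ := fun v => {t ∈ Set.Ico (0 : ℝ) 1 | γ t = v}
  have hA : ∀ v, MeasurableSet (A v) := by
    intro v
    refine Set.OrdConnected.measurableSet ⟨fun s hs t ht r hr => ?_⟩
    have hr' : r ∈ Set.Ico (0 : ℝ) 1 := ⟨hs.1.1.trans hr.1, hr.2.trans_lt ht.1.2⟩
    refine ⟨hr', le_antisymm ?_ ?_⟩
    · rw [← ht.2]; exact hγ hr' ht.1 hr.2
    · rw [← hs.2]; exact hγ hs.1 hr' hr.1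
  have hAsub : ∀ v, A v ⊆ Set.Ico (0 : ℝ) 1 := fun v t ht => ht.1
  let x : V → ℝ := fun v => MeasureTheory.volume.real (A v)
  have h_integral : ∀ g : V → ℝ, wsum x g = ∫ t in Set.Ico (0 : ℝ) 1, g (γ t) := by
    intro g
    have h1 : ∫ t in Set.Ico (0 : ℝ) 1, g (γ t) =
        ∫ t in Set.Ico (0 : ℝ) 1, ∑ v, (A v).indicator (fun _ => g v) t := by
      refine MeasureTheory.setIntegral_congr_fun measurableSet_Ico fun t ht => ?_
      change _ = ∑ v, (A v).indicator (fun _ => g v) t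
      rw [Finset.sum_eq_single (γ t)]
      · rw [Set.indicator_of_mem (show t ∈ A (γ t) from ⟨ht, rfl⟩)]
      · intro v _ hv
        rw [Set.indicator_of_notMem]
        exact fun h => hv h.2.symm
      · simp
    rw [h1, MeasureTheory.integral_finsetSum]
    · refine Finset.sum_congr rfl fun v _ => ?_
      rw [MeasureTheory.setIntegral_indicator (hA v), Set.inter_eq_self_of_subset_right (hAsub v)]
      simp [x]
    · intro v _
      refine MeasureTheory.Integrable.indicator ?_ (hA v)
      exact MeasureTheory.integrable_const _
  have hxA : ∀ v, x v ≠ 0 → (A v).Nonempty := by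
    intro v hv
    by_contra h
    rw [Set.not_nonempty_iff_eq_empty] at h
    exact hv (by simp [x, h])
  refine ⟨x, mem_realization_orderC.2 ⟨fun v => MeasureTheory.measureReal_nonneg, ?_, ?_, ?_⟩, h_integral⟩
  · intro v hv
    obtain ⟨t, ht, rfl⟩ := hxA v hv
    exact hS t ht
  · intro v hv w hw _
    obtain ⟨s, hs, rfl⟩ := hxA v hv
    obtain ⟨t, ht, rfl⟩ := hxA w hw
    rcases le_total s t with h | h
    · exact Or.inl (hγ hs ht h)
    · exact Or.inr (hγ ht hs h)
  · have := h_integral fun _ => 1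
    simpa [wsum] using this

end Placement

end SComplex

/-- The integral over the unit interval of a step function with two breakpoints. -/
lemma setIntegral_step {h : ℝ → ℝ} {a b c s t : ℝ} (hs : s ∈ Set.Icc (0 : ℝ) 1)
    (ht : t ∈ Set.Icc (0 : ℝ) 1) (hh : ∀ r ∈ Set.Ico (0 : ℝ) 1,
      h r = a + b * (if r < s then 1 else 0) + c * (if r < t then 1 else 0)) :
    ∫ r in Set.Ico (0 : ℝ) 1, h r = a + b * s + c * t := by
  have hstep : ∀ s ∈ Set.Icc (0 : ℝ) 1,
      MeasureTheory.IntegrableOn (fun r : ℝ => if r < s then (1 : ℝ) else 0) (Set.Ico 0 1) ∧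
      ∫ r in Set.Ico (0 : ℝ) 1, (if r < s then (1 : ℝ) else 0) = s := by
    intro s hs
    have heq : (fun r : ℝ => if r < s then (1 : ℝ) else 0) = (Set.Iio s).indicator fun _ => 1 := by
      ext r
      simp [Set.indicator_apply]
    rw [heq]
    constructor
    · exact (MeasureTheory.integrable_const _).indicator measurableSet_Iio
    · rw [MeasureTheory.setIntegral_indicator measurableSet_Iio]
      have : Set.Ico (0 : ℝ) 1 ∩ Set.Iio s = Set.Ico 0 s := by
        ext r
        simp only [Set.mem_inter_iff, Set.mem_Ico, Set.mem_Iio]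
        exact ⟨fun h => ⟨h.1.1, h.2⟩, fun h => ⟨⟨h.1, h.2.trans_le hs.2⟩, h.2⟩⟩
      rw [this]
      simp [hs.1]
  rw [MeasureTheory.setIntegral_congr_fun measurableSet_Ico hh,
    MeasureTheory.integral_add, MeasureTheory.integral_add, MeasureTheory.integral_const_mul,
    MeasureTheory.integral_const_mul, (hstep s hs).2, (hstep t ht).2]
  · simp
  · exact MeasureTheory.integrable_const _
  · exact (hstep s hs).1.const_mul b
  · exact (MeasureTheory.integrable_const _).add ((hstep s hs).1.const_mul b)
  · exact (hstep t ht).1.const_mul c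

/-! ### Cells of the doubled grid in integer coordinates

A cell of the double of the `m`-grid on `Iⁿ` is encoded by the doubled coordinates of its
barycenter: even entries are grid points, odd entries are unit intervals. -/

/-- The face order on the cells of a subdivided line, in doubled coordinates. -/
def LineLe (a b : ℤ) : Prop := a = b ∨ (b % 2 = 1 ∧ (a = b + 1 ∨ a = b - 1))

lemma LineLe.refl (a : ℤ) : LineLe a a := Or.inl rfl

lemma LineLe.trans {a b c : ℤ} (h : LineLe a b) (h' : LineLe b c) : LineLe a c := by
  unfold LineLe at *
  omega

lemma LineLe.antisymm {a b : ℤ} (h : LineLe a b) (h' : LineLe b a) : a = b := by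
  unfold LineLe at *
  omega

/-- Doubled coordinates describing a cell in the boundary of the `m`-grid. -/
def AtBdry {n : ℕ} (m : ℕ) (e : Fin n → ℤ) : Prop := ∃ i, e i = 0 ∨ e i = 2 * m

lemma AtBdry.mono {n m : ℕ} {e e' : Fin n → ℤ} (h : ∀ i, LineLe (e i) (e' i))
    (h' : AtBdry m e') : AtBdry m e := by
  obtain ⟨i, hi⟩ := h'
  refine ⟨i, ?_⟩
  have := h i
  unfold LineLe at this
  omega

/-- A cell of the double of the `m`-grid on `Iⁿ`. -/
@[ext]
structure Cell (n m : ℕ) where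
  coord : Fin n → ℤ
  tag : Bool
  mem_range : ∀ i, 0 ≤ coord i ∧ coord i ≤ 2 * m
  tag_eq : AtBdry m coord → tag = false

namespace Cell

variable {n m : ℕ}

instance : Finite (Cell n m) := by
  have : Finite (Set.Icc (0 : Fin n → ℤ) (fun _ => 2 * (m : ℤ))) := Set.finite_Icc _ _
  refine Finite.of_injective
    (fun c : Cell n m => ((⟨c.coord, fun i => (c.mem_range i).1, fun i => (c.mem_range i).2⟩ :
      Set.Icc (0 : Fin n → ℤ) (fun _ => 2 * (m : ℤ))), c.tag)) fun c c' h => ?_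
  simp only [Prod.mk.injEq] at h
  exact Cell.ext (congrArg Subtype.val h.1) h.2

instance : PartialOrder (Cell n m) where
  le p q := (∀ i, LineLe (p.coord i) (q.coord i)) ∧ (p.tag = q.tag ∨ AtBdry m p.coord)
  le_refl p := ⟨fun i => LineLe.refl _, Or.inl rfl⟩
  le_trans p q r hpq hqr := by
    refine ⟨fun i => (hpq.1 i).trans (hqr.1 i), ?_⟩
    rcases hpq.2 with h | h
    · rcases hqr.2 with h' | h'
      · exact Or.inl (h.trans h')
      · exact Or.inr (h'.mono hpq.1)
    · exact Or.inr h
  le_antisymm p q hpq hqp := by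
    have hc : p.coord = q.coord := funext fun i => (hpq.1 i).antisymm (hqp.1 i)
    refine Cell.ext hc ?_
    rcases hpq.2 with h | h
    · exact h
    · rw [p.tag_eq h, q.tag_eq (hc ▸ h)]

lemma le_def {p q : Cell n m} : p ≤ q ↔
    (∀ i, LineLe (p.coord i) (q.coord i)) ∧ (p.tag = q.tag ∨ AtBdry m p.coord) := Iff.rfl

end Cell

/-- The smallest coarse cell of the line containing a cell of the twice finer line. -/
def lineCarrier (a : ℤ) : ℤ := if a % 4 = 0 then a / 2 else 2 * (a / 4) + 1

lemma lineCarrier_mono {a b : ℤ} (h : LineLe a b) : LineLe (lineCarrier a) (lineCarrier b) := by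
  unfold LineLe at *
  unfold lineCarrier
  split_ifs <;> omega

lemma atBdry_lineCarrier {n m : ℕ} {e : Fin n → ℤ} :
    AtBdry m (fun i => lineCarrier (e i)) ↔ AtBdry (2 * m) e := by
  refine exists_congr fun i => ?_
  unfold lineCarrier
  push_cast
  split_ifs <;> omega

/-- The smallest coarse cell containing a given fine cell. -/
def Cell.carrier {n m : ℕ} (c : Cell n (2 * m)) : Cell n m where
  coord i := lineCarrier (c.coord i)
  tag := c.tag
  mem_range i := by
    have := c.mem_range i
    push_cast at this
    unfold lineCarrier
    split_ifs <;> omega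
  tag_eq h := c.tag_eq (atBdry_lineCarrier.1 h)

lemma Cell.carrier_mono {n m : ℕ} {c c' : Cell n (2 * m)} (h : c ≤ c') :
    c.carrier ≤ c'.carrier :=
  ⟨fun i => lineCarrier_mono (h.1 i), h.2.imp id fun h => atBdry_lineCarrier.2 h⟩

/-- Fine and coarse cells together. -/
inductive Vtx (n m : ℕ) where
  | fine : Cell n (2 * m) → Vtx n m
  | coarse : Cell n m → Vtx n m

namespace Vtx

variable {n m : ℕ}

instance : Finite (Vtx n m) := by
  refine Finite.of_surjective
    (fun s : Cell n (2 * m) ⊕ Cell n m => Sum.elim Vtx.fine Vtx.coarse s) ?_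
  rintro (c | Q)
  · exact ⟨Sum.inl c, rfl⟩
  · exact ⟨Sum.inr Q, rfl⟩

noncomputable instance : Fintype (Vtx n m) := Fintype.ofFinite _

/-- Inclusion of cells; a coarse cell is never below a fine one. -/
def Le : Vtx n m → Vtx n m → Prop
  | fine c, fine c' => c ≤ c'
  | fine c, coarse Q => c.carrier ≤ Q
  | coarse _, fine _ => False
  | coarse Q, coarse Q' => Q ≤ Q'

instance : PartialOrder (Vtx n m) where
  le := Le
  le_refl
    | fine c => le_refl c
    | coarse Q => le_refl Q
  le_trans
    | fine _, fine _, fine _, h, h' => le_trans (α := Cell n (2 * m)) h h'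
    | fine _, fine _, coarse _, h, h' => le_trans (Cell.carrier_mono h) h'
    | fine _, coarse _, coarse _, h, h' => le_trans (α := Cell n m) h h'
    | coarse _, coarse _, coarse _, h, h' => le_trans (α := Cell n m) h h'
  le_antisymm
    | fine _, fine _, h, h' => congrArg fine (le_antisymm (α := Cell n (2 * m)) h h')
    | coarse _, coarse _, h, h' => congrArg coarse (le_antisymm (α := Cell n m) h h')

@[simp] lemma fine_le_fine {c c' : Cell n (2 * m)} : fine c ≤ fine c' ↔ c ≤ c' := Iff.rfl
@[simp] lemma fine_le_coarse {c : Cell n (2 * m)} {Q : Cell n m} :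
    fine c ≤ coarse Q ↔ c.carrier ≤ Q := Iff.rfl
@[simp] lemma not_coarse_le_fine {c : Cell n (2 * m)} {Q : Cell n m} :
    ¬ coarse Q ≤ fine c := fun h => h
@[simp] lemma coarse_le_coarse {Q Q' : Cell n m} : coarse Q ≤ coarse Q' ↔ Q ≤ Q' := Iff.rfl

/-- The vertices after the coarse cells in `U` have been starred. -/
def stage (U : Set (Cell n m)) : Set (Vtx n m)
  | fine c => c.carrier ∉ U
  | coarse Q => Q ∈ U

/-- The vertices of the disk starred at the coarse cell `F`. -/
def disk (F : Cell n m) : Set (Vtx n m)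
  | fine c => c.carrier ≤ F
  | coarse Q => F < Q

/-- The vertices of the boundary of the disk starred at the coarse cell `F`. -/
def diskBdry (F : Cell n m) : Set (Vtx n m)
  | fine c => c.carrier < F
  | coarse Q => F < Q

lemma fine_mem_stage {U : Set (Cell n m)} {c : Cell n (2 * m)} :
    fine c ∈ stage U ↔ c.carrier ∉ U := Iff.rfl
lemma coarse_mem_stage {U : Set (Cell n m)} {Q : Cell n m} : coarse Q ∈ stage U ↔ Q ∈ U := Iff.rfl
lemma fine_mem_disk {F : Cell n m} {c : Cell n (2 * m)} :
    fine c ∈ disk F ↔ c.carrier ≤ F := Iff.rfl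
lemma coarse_mem_disk {F Q : Cell n m} : coarse Q ∈ disk F ↔ F < Q := Iff.rfl
lemma fine_mem_diskBdry {F : Cell n m} {c : Cell n (2 * m)} :
    fine c ∈ diskBdry F ↔ c.carrier < F := Iff.rfl
lemma coarse_mem_diskBdry {F Q : Cell n m} : coarse Q ∈ diskBdry F ↔ F < Q := Iff.rfl

lemma diskBdry_subset_disk (F : Cell n m) : diskBdry F ⊆ disk F := by
  rintro (c | Q) h
  · exact (fine_mem_diskBdry.1 h).le
  · exact h

lemma isStarring_stage {U : Set (Cell n m)} (hU : IsUpperSet U) {F : Cell n m} (hF : F ∉ U)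
    (hmax : ∀ Q, F < Q → Q ∈ U) {r : ℤ} (hr : ((disk F).ncard : ℤ) ≤ r)
    (hdisk : SComplex.IsTriangulatedDisk (SComplex.orderC (disk F))
      (SComplex.orderC (diskBdry F)) n) :
    SComplex.IsStarring r (SComplex.orderC (stage U)) (SComplex.orderC (stage (insert F U))) := by
  refine ⟨_, _, n, coarse F, SComplex.isStarringAt_orderC ?_ (Set.toFinite _) hr hdisk ?_ ?_
    (diskBdry_subset_disk F) ?_ ?_⟩
  · rintro (c | Q) h
    · exact fun h' => hF (hU (fine_mem_disk.1 h) h')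
    · exact hmax Q h
  · rintro a ha (c | Q) hb hbB hab
    · have hc : c.carrier = F := by
        rcases (fine_mem_disk.1 hb).eq_or_lt with h | h
        · exact h
        · exact absurd (fine_mem_diskBdry.2 h) hbB
      rcases a with c' | Q
      · rw [fine_mem_disk]
        rcases hab with h | h
        · exact hc ▸ Cell.carrier_mono h
        · have h1 : F ≤ c'.carrier := hc ▸ Cell.carrier_mono (fine_le_fine.1 h)
          rcases h1.eq_or_lt with h2 | h2
          · exact h2.symm.le
          · exact absurd (hmax _ h2) ha
      · rw [coarse_mem_disk]
        rcases hab with h | h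
        · exact absurd h not_coarse_le_fine
        · rw [fine_le_coarse, hc] at h
          refine lt_of_le_of_ne h ?_
          rintro rfl
          exact hF ha
    · exact absurd hb hbB
  · exact hF
  · ext (c | Q)
    · simp only [Set.mem_insert_iff, Set.mem_sdiff, fine_mem_stage, fine_mem_disk,
        fine_mem_diskBdry, reduceCtorEq, false_or, not_or, not_and, not_not]
      constructor
      · rintro ⟨h1, h2⟩
        exact ⟨h2, fun h => lt_of_le_of_ne h h1⟩
      · rintro ⟨h1, h2⟩
        exact ⟨fun h => (h2 h.le).ne h, h1⟩
    · simp only [Set.mem_insert_iff, Set.mem_sdiff, coarse_mem_stage, coarse_mem_disk,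
        coarse_mem_diskBdry, coarse.injEq, not_and, not_not]
      tauto
  · rintro (c | Q) ⟨ha, ha'⟩
    · simp only [fine_le_coarse, not_coarse_le_fine, or_false, fine_mem_diskBdry]
      refine ⟨fun h => ?_, le_of_lt⟩
      by_contra h'
      exact ha' ⟨h, h'⟩
    · simp only [coarse_le_coarse, coarse_mem_diskBdry]
      have hQF : Q ≠ F := by
        rintro rfl
        exact hF ha
      constructor
      · rintro (h | h)
        · exact absurd (hU h ha) hF
        · exact lt_of_le_of_ne h hQF.symm
      · exact fun h => Or.inr h.le

lemma starsTo_stage {r : ℤ} (hr : ∀ F : Cell n m, ((disk F).ncard : ℤ) ≤ r)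
    (hdisk : ∀ F : Cell n m, SComplex.IsTriangulatedDisk (SComplex.orderC (disk F))
      (SComplex.orderC (diskBdry F)) n) (U : Set (Cell n m)) (hU : IsUpperSet U) :
    SComplex.StarsTo r (SComplex.orderC (stage ∅)) (SComplex.orderC (stage U)) := by
  induction hN : U.ncard generalizing U with
  | zero =>
    rw [Set.ncard_eq_zero] at hN
    rw [hN]
    exact Relation.ReflTransGen.refl
  | succ N ih =>
    have hne : U.Nonempty := by
      rw [Set.nonempty_iff_ne_empty]
      rintro rfl
      simp at hN
    obtain ⟨F, hF⟩ := U.toFinite.exists_minimal hne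
    have hU' : IsUpperSet (U \ {F}) := by
      rintro a b hab ⟨ha, haF⟩
      refine ⟨hU hab ha, ?_⟩
      rintro rfl
      exact haF (le_antisymm hab (hF.2 ha hab))
    have h := ih (U \ {F}) hU' (by rw [Set.ncard_sdiff_singleton_of_mem hF.1, hN]; rfl)
    refine h.tail ?_
    have := isStarring_stage hU' (F := F) (by simp)
      (fun Q hQ => ⟨hU hQ.le hF.1, hQ.ne'⟩) (hr F) (hdisk F)
    rwa [Set.insert_sdiff_singleton, Set.insert_eq_of_mem hF.1] at this

end Vtx

/-! ### Comparison with the grid triangulations -/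

lemma SComplex.isIsoMap_orderC {V W : Type*} [PartialOrder V] {S : Set V} {L : SComplex W}
    {f : V → W} (hinj : Set.InjOn f S)
    (hfaces : ∀ σ : Finset V, ↑σ ⊆ S →
      (σ.image f ∈ L.faces ↔ σ.Nonempty ∧ IsChain (· ≤ ·) (σ : Set V)))
    (hsurj : ∀ τ ∈ L.faces, ∀ p ∈ τ, ∃ v ∈ S, f v = p) : IsIsoMap f (orderC S) L := by
  refine ⟨by rwa [vertexSet_orderC], fun σ hσ => (hfaces σ hσ.2.1).2 ⟨hσ.1, hσ.2.2⟩,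
    fun τ hτ => ?_⟩
  have : Nonempty V := by
    obtain rfl | ⟨p, hp⟩ := τ.eq_empty_or_nonempty
    · exact absurd hτ L.not_empty_mem
    · exact ⟨(hsurj τ hτ p hp).choose⟩
  choose! g hgS hg using hsurj τ hτ
  have himg : (τ.image g).image f = τ := by
    rw [Finset.image_image]
    conv_rhs => rw [← Finset.image_id (s := τ)]
    exact Finset.image_congr fun p hp => hg p hp
  have hS : ↑(τ.image g) ⊆ S := by
    rw [Finset.coe_image]
    rintro _ ⟨p, hp, rfl⟩
    exact hgS p hp
  obtain ⟨h1, h2⟩ := (hfaces _ hS).1 (by rwa [himg])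
  exact ⟨τ.image g, ⟨h1, hS, h2⟩, himg⟩

/-- The grid cube with tag described by a cell. -/
def Cell.toGrid {n m : ℕ} (c : Cell n m) : GridCube n × Bool :=
  (fun i => ((c.coord i / 2).toNat, decide (c.coord i % 2 = 1)), c.tag)

namespace Cell

variable {n m : ℕ}

lemma atBdry_iff_onBdry {k : ℕ} (hm : m = 2 ^ k) (c : Cell n m) :
    AtBdry m c.coord ↔ OnBdry k c.toGrid.1 := by
  refine exists_congr fun i => ?_
  have h := c.mem_range i
  simp only [toGrid, ← hm, decide_eq_false_iff_not]
  omega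

lemma lineLe_iff (c c' : Cell n m) (i : Fin n) : LineLe (c.coord i) (c'.coord i) ↔
    (((c'.toGrid.1 i).2 = true →
          (c.toGrid.1 i = c'.toGrid.1 i ∨ ((c.toGrid.1 i).2 = false ∧
            ((c.toGrid.1 i).1 = (c'.toGrid.1 i).1 ∨ (c.toGrid.1 i).1 = (c'.toGrid.1 i).1 + 1)))) ∧
       ((c'.toGrid.1 i).2 = false → c.toGrid.1 i = c'.toGrid.1 i)) := by
  have h := c.mem_range i
  have h' := c'.mem_range i
  simp only [toGrid, LineLe, Prod.mk.injEq, decide_eq_true_eq, decide_eq_false_iff_not,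
    decide_eq_decide]
  omega

lemma le_iff_doubleCubeFace {k : ℕ} (hm : m = 2 ^ k) (c c' : Cell n m) :
    c ≤ c' ↔ DoubleCubeFace k c.toGrid c'.toGrid := by
  rw [le_def, DoubleCubeFace, ← atBdry_iff_onBdry hm]
  exact and_congr (forall_congr' fun i => lineLe_iff c c' i) Iff.rfl

lemma validCube_toGrid (c : Cell n m) : ValidCube (fun _ => m) c.toGrid.1 := by
  intro i
  have h := c.mem_range i
  simp only [toGrid, decide_eq_true_eq, decide_eq_false_iff_not]
  omega

lemma exists_toGrid_eq {k : ℕ} (hm : m = 2 ^ k) {p : GridCube n × Bool}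
    (hp : ValidCube (fun _ => m) p.1) (ht : OnBdry k p.1 → p.2 = false) :
    ∃ c : Cell n m, c.toGrid = p := by
  refine ⟨⟨fun i => 2 * ((p.1 i).1 : ℤ) + (if (p.1 i).2 = true then 1 else 0), p.2, fun i => ?_,
    fun h => ht ?_⟩, ?_⟩
  · split_ifs with h
    · have : (p.1 i).1 < m := (hp i).1 h
      omega
    · have : (p.1 i).1 ≤ m := (hp i).2 (by simpa using h)
      omega
  · obtain ⟨i, hi⟩ := h
    refine ⟨i, ?_⟩
    rw [← hm]
    by_cases h : (p.1 i).2 = true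
    · simp only [h, if_true] at hi
      omega
    · simp only [h] at hi
      refine ⟨by simpa using h, ?_⟩
      simp only [Bool.false_eq_true, if_false] at hi
      omega
  · refine Prod.ext (funext fun i => ?_) rfl
    simp only [toGrid]
    refine Prod.ext ?_ ?_
    · simp only
      split_ifs <;> omega
    · by_cases h : (p.1 i).2 = true
      · simp only [h, if_true, decide_eq_true_eq]
        omega
      · simp [h]

lemma toGrid_injective : Function.Injective (toGrid : Cell n m → GridCube n × Bool) := by
  intro c c' h
  refine Cell.ext (funext fun i => ?_) (congrArg Prod.snd h)
  have h1 := congrFun (congrArg Prod.fst h) i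
  simp only [toGrid, Prod.mk.injEq, decide_eq_decide] at h1
  have h := c.mem_range i
  have h' := c'.mem_range i
  omega

/-- The order complex of the cells of the doubled `2^k`-grid is the triangulation `L_k`. -/
lemma iso_orderC_range {V : Type*} [PartialOrder V] {k : ℕ} (hm : m = 2 ^ k)
    (g : Cell n m ↪o V) :
    SComplex.Iso (SComplex.orderC (Set.range g)) (sphereGrid n k) := by
  let f : V → GridCube n × Bool := Function.extend g toGrid fun _ => (fun _ => (0, false), false)
  have hf : ∀ c, f (g c) = c.toGrid := fun c => g.injective.extend_apply _ _ c
  refine ⟨f, SComplex.isIsoMap_orderC ?_ (fun σ hσ => ?_) ?_⟩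
  · rintro _ ⟨c, rfl⟩ _ ⟨c', rfl⟩ h
    rw [hf, hf] at h
    rw [toGrid_injective h]
  · have hmem : ∀ {v}, v ∈ σ → ∃ c : Cell n m, g c = v := fun hv => hσ hv
    constructor
    · rintro ⟨hne, -, hc⟩
      refine ⟨by simpa using hne, fun v hv w hw _ => ?_⟩
      have := hc (f v) (by simpa using ⟨v, hv, rfl⟩) (f w) (by simpa using ⟨w, hw, rfl⟩)
      obtain ⟨c, rfl⟩ := hmem hv
      obtain ⟨c', rfl⟩ := hmem hw
      rw [hf, hf, ← le_iff_doubleCubeFace hm, ← le_iff_doubleCubeFace hm] at this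
      simpa using this
    · rintro ⟨hne, hc⟩
      refine ⟨by simpa using hne, fun p hp => ?_, fun p hp q hq => ?_⟩
      · simp only [Finset.mem_image] at hp
        obtain ⟨v, hv, rfl⟩ := hp
        obtain ⟨c, rfl⟩ := hσ hv
        rw [hf]
        exact ⟨hm ▸ c.validCube_toGrid, fun h => c.tag_eq ((atBdry_iff_onBdry hm c).2 h)⟩
      · simp only [Finset.mem_image] at hp hq
        obtain ⟨v, hv, rfl⟩ := hp
        obtain ⟨w, hw, rfl⟩ := hq
        have := hc.total hv hw
        obtain ⟨c, rfl⟩ := hσ hv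
        obtain ⟨c', rfl⟩ := hσ hw
        rw [hf, hf, ← le_iff_doubleCubeFace hm, ← le_iff_doubleCubeFace hm]
        simpa using this
  · rintro τ ⟨-, hval, -⟩ p hp
    obtain ⟨c, rfl⟩ := exists_toGrid_eq hm (by rw [hm]; exact (hval p hp).1) (hval p hp).2
    exact ⟨g c, ⟨c, rfl⟩, hf c⟩

end Cell

namespace Vtx

variable {n m : ℕ}

lemma stage_empty : stage (∅ : Set (Cell n m)) =
    Set.range (OrderEmbedding.ofMapLEIff (fine (n := n) (m := m)) fun _ _ => fine_le_fine) := by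
  ext (c | Q)
  · simp [fine_mem_stage]
  · simp [coarse_mem_stage]

lemma stage_univ : stage (Set.univ : Set (Cell n m)) =
    Set.range (OrderEmbedding.ofMapLEIff (coarse (n := n) (m := m)) fun _ _ => coarse_le_coarse) := by
  ext (c | Q)
  · simp [fine_mem_stage]
  · simp [coarse_mem_stage]

end Vtx

/-! ### The gauge of the local model

The disk starred at a cell `F` is mapped to a convex body of `ℝⁿ`. Here `T` is the set of
directions tangent to `F` and `B` the set of directions normal to `∂Iⁿ` at `F`; in the latter the
two sheets of the double are distinguished by sign. -/

section Gauge

variable {n : ℕ} (T B : Fin n → Prop)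

/-- The depth of a point in the second sheet. -/
noncomputable def sheetDepth (z : Fin n → ℝ) : ℝ := ‖fun i => if B i then max 0 (-z i) else 0‖

/-- The distances of a point from the walls through the center. -/
noncomputable def wallDist (z : Fin n → ℝ) : Fin n → ℝ := fun i =>
  if T i then 0 else if B i then z i + 2 * sheetDepth B z else |z i|

/-- The tangential component of a point. -/
noncomputable def tangentPart (z : Fin n → ℝ) : Fin n → ℝ := fun i => if T i then z i else 0

/-- The gauge of the local model. -/
noncomputable def cellGauge (z : Fin n → ℝ) : ℝ := ‖tangentPart T z‖ / 2 + ‖wallDist T B z‖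

variable {T B}

lemma sheetDepth_nonneg (z : Fin n → ℝ) : 0 ≤ sheetDepth B z := norm_nonneg _

lemma neg_le_sheetDepth {i : Fin n} (hi : B i) (z : Fin n → ℝ) : -z i ≤ sheetDepth B z := by
  have h := norm_le_pi_norm (fun i => if B i then max 0 (-z i) else 0) i
  simp only [hi, if_true] at h
  exact (le_max_right _ _).trans ((le_abs_self _).trans h)

lemma sheetDepth_le {z : Fin n → ℝ} {c : ℝ} (hc : 0 ≤ c) (h : ∀ i, B i → -z i ≤ c) :
    sheetDepth B z ≤ c := by
  refine (pi_norm_le_iff_of_nonneg hc).2 fun i => ?_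
  split_ifs with hi
  · rw [Real.norm_of_nonneg (le_max_left _ _)]
    exact max_le hc (h i hi)
  · simpa

lemma sheetDepth_eq {z : Fin n → ℝ} {c : ℝ} {i : Fin n} (hc : 0 ≤ c) (h : ∀ i, B i → -z i ≤ c)
    (hi : B i) (hi' : c ≤ max 0 (-z i)) : sheetDepth B z = c :=
  le_antisymm (sheetDepth_le hc h)
    (hi'.trans (max_le (sheetDepth_nonneg z) (neg_le_sheetDepth hi z)))

lemma exists_neg_of_sheetDepth_pos {z : Fin n → ℝ} (h : 0 < sheetDepth B z) :
    ∃ i, B i ∧ -z i = sheetDepth B z := by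
  by_contra! hne
  have hlt : ∀ i, ‖if B i then max 0 (-z i) else 0‖ < sheetDepth B z := by
    intro i
    split_ifs with hi
    · rw [Real.norm_of_nonneg (le_max_left _ _)]
      exact max_lt h (lt_of_le_of_ne (neg_le_sheetDepth hi z) (hne i hi))
    · simpa
  exact lt_irrefl _ ((pi_norm_lt_iff h).2 hlt)

lemma sheetDepth_add (y z : Fin n → ℝ) :
    sheetDepth B (y + z) ≤ sheetDepth B y + sheetDepth B z := by
  refine sheetDepth_le (add_nonneg (sheetDepth_nonneg y) (sheetDepth_nonneg z)) fun i hi => ?_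
  have h1 := neg_le_sheetDepth hi y
  have h2 := neg_le_sheetDepth hi z
  simp only [Pi.add_apply]
  linarith

lemma sheetDepth_smul {c : ℝ} (hc : 0 ≤ c) (z : Fin n → ℝ) :
    sheetDepth B (c • z) = c * sheetDepth B z := by
  rw [sheetDepth, sheetDepth, ← Real.norm_of_nonneg hc, ← norm_smul]
  congr 1
  funext i
  simp only [Pi.smul_apply, smul_eq_mul, mul_ite, mul_zero, mul_max_of_nonneg _ _ hc,
    Real.norm_of_nonneg hc, mul_neg]

lemma continuous_sheetDepth : Continuous (sheetDepth B : (Fin n → ℝ) → ℝ) := by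
  refine continuous_norm.comp (continuous_pi fun i => ?_)
  split_ifs
  · fun_prop
  · fun_prop

lemma wallDist_nonneg (z : Fin n → ℝ) (i : Fin n) : 0 ≤ wallDist T B z i := by
  unfold wallDist
  split_ifs with h1 h2
  · exact le_rfl
  · linarith [neg_le_sheetDepth h2 z, sheetDepth_nonneg (B := B) z]
  · exact abs_nonneg _

lemma sheetDepth_le_wallDist {i : Fin n} (hT : ¬ T i) (hi : B i) (z : Fin n → ℝ) :
    sheetDepth B z ≤ wallDist T B z i := by
  simp only [wallDist, hT, hi, if_true, if_false]
  linarith [neg_le_sheetDepth hi z]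

lemma wallDist_le_norm (z : Fin n → ℝ) (i : Fin n) : wallDist T B z i ≤ ‖wallDist T B z‖ :=
  (le_abs_self _).trans (norm_le_pi_norm (wallDist T B z) i)

lemma wallDist_add (y z : Fin n → ℝ) (i : Fin n) :
    wallDist T B (y + z) i ≤ wallDist T B y i + wallDist T B z i := by
  unfold wallDist
  split_ifs
  · simp
  · have := sheetDepth_add (B := B) y z
    simp only [Pi.add_apply]
    linarith
  · exact abs_add_le _ _

lemma wallDist_smul {c : ℝ} (hc : 0 ≤ c) (z : Fin n → ℝ) :
    wallDist T B (c • z) = c • wallDist T B z := by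
  funext i
  simp only [wallDist, Pi.smul_apply, smul_eq_mul, sheetDepth_smul hc, abs_mul, abs_of_nonneg hc]
  split_ifs <;> ring

lemma continuous_cellGauge : Continuous (cellGauge T B) := by
  have h1 : Continuous (tangentPart T) := continuous_pi fun i => by
    unfold tangentPart
    split_ifs <;> fun_prop
  have h2 : Continuous (wallDist T B) := continuous_pi fun i => by
    have := continuous_sheetDepth (B := B)
    unfold wallDist
    split_ifs <;> fun_prop
  unfold cellGauge
  fun_prop

lemma cellGauge_add (y z : Fin n → ℝ) :
    cellGauge T B (y + z) ≤ cellGauge T B y + cellGauge T B z := by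
  have h1 : tangentPart T (y + z) = tangentPart T y + tangentPart T z := by
    funext i
    simp only [tangentPart, Pi.add_apply]
    split_ifs <;> simp
  have h2 : ‖wallDist T B (y + z)‖ ≤ ‖wallDist T B y‖ + ‖wallDist T B z‖ := by
    refine (pi_norm_le_iff_of_nonneg (by positivity)).2 fun i => ?_
    rw [Real.norm_of_nonneg (wallDist_nonneg _ i)]
    exact (wallDist_add y z i).trans (add_le_add (wallDist_le_norm y i) (wallDist_le_norm z i))
  have h3 := norm_add_le (tangentPart T y) (tangentPart T z)
  simp only [cellGauge, h1]
  linarith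

lemma cellGauge_smul (c : ℝ) (hc : 0 ≤ c) (z : Fin n → ℝ) :
    cellGauge T B (c • z) = c * cellGauge T B z := by
  have h1 : tangentPart T (c • z) = c • tangentPart T z := by
    funext i
    simp [tangentPart]
  rw [cellGauge, cellGauge, h1, wallDist_smul hc, norm_smul, norm_smul, Real.norm_of_nonneg hc]
  ring

lemma norm_le_two_mul_cellGauge (z : Fin n → ℝ) : ‖z‖ ≤ 2 * cellGauge T B z := by
  have h0 : 0 ≤ cellGauge T B z := by
    unfold cellGauge
    positivity
  refine (pi_norm_le_iff_of_nonneg (by positivity)).2 fun i => ?_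
  have h1 := norm_le_pi_norm (tangentPart T z) i
  have h2 := wallDist_le_norm (T := T) (B := B) z i
  have h3 := norm_nonneg (tangentPart T z)
  have h4 := norm_nonneg (wallDist T B z)
  unfold cellGauge
  by_cases hT : T i
  · simp only [tangentPart, hT, if_true] at h1
    linarith
  · have : ‖z i‖ ≤ wallDist T B z i := by
      by_cases hB : B i
      · have h5 := sheetDepth_le_wallDist hT hB z
        have h6 := neg_le_sheetDepth hB z
        have h7 := sheetDepth_nonneg (B := B) z
        rw [Real.norm_eq_abs]
        refine abs_le.2 ⟨by linarith, ?_⟩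
        simp only [wallDist, hT, hB, if_true, if_false]
        linarith
      · simp [wallDist, hT, hB]
    linarith

end Gauge

/-! ### The disk starred at a cell -/

lemma mass_level {V : Type*} [Fintype V] {x : V → ℝ} (h0 : ∀ v, 0 ≤ x v) {C : Set V} {e : V → ℤ}
    (hC : ∀ v, x v ≠ 0 → v ∉ C → e v = 0)
    (he : ∀ v w, x v ≠ 0 → x w ≠ 0 → v ∈ C → w ∈ C → e v ≤ e w + 1) (p : ℤ) :
    mass x {v | v ∈ C ∧ e v = p} =
      max 0 (mass x C - |wsum x (fun v => (e v : ℝ)) - mass x C * p|) := by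
  have hz : wsum x (fun v => (e v : ℝ)) - mass x C * p =
      wsum x fun v => C.indicator 1 v * ((e v : ℝ) - p) := by
    rw [mul_comm, mass, ← wsum_const_mul, ← wsum_sub]
    refine wsum_congr fun v hv => ?_
    by_cases h : v ∈ C
    · simp [h]
    · simp [h, hC v hv h]
  have hsub : mass x C - mass x {v | v ∈ C ∧ e v = p} =
      wsum x fun v => C.indicator 1 v * (if e v = p then 0 else 1) := by
    rw [mass, mass, ← wsum_sub]
    refine wsum_congr fun v _ => ?_
    by_cases h : v ∈ C <;> by_cases h' : e v = p <;> simp [h, h']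
  have hnonneg := mass_nonneg h0 {v | v ∈ C ∧ e v = p}
  have hf := mass_nonneg h0 C
  rw [hz]
  by_cases hp : ∃ v, x v ≠ 0 ∧ v ∈ C ∧ e v = p
  · obtain ⟨v, hv, hvC, hvp⟩ := hp
    have key : |wsum x fun v => C.indicator 1 v * ((e v : ℝ) - p)| =
        mass x C - mass x {v | v ∈ C ∧ e v = p} := by
      have hle := mass_mono h0 (C := {v | v ∈ C ∧ e v = p}) (C' := C) fun _ _ h => h.1
      by_cases hp1 : ∃ w, x w ≠ 0 ∧ w ∈ C ∧ e w = p + 1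
      · obtain ⟨w, hw, hwC, hwp⟩ := hp1
        rw [← abs_of_nonneg (sub_nonneg.2 hle), hsub]
        congr 1
        refine wsum_congr fun u hu => ?_
        by_cases h : u ∈ C
        · have h1 := he u v hu hv h hvC
          have h2 := he w u hw hu hwC h
          have h3 : e u = p ∨ e u = p + 1 := by omega
          rcases h3 with h3 | h3 <;> simp [h3]
        · simp [h]
      · rw [← abs_of_nonneg (sub_nonneg.2 hle), ← abs_neg, hsub, ← wsum_neg]
        congr 1
        refine wsum_congr fun u hu => ?_
        by_cases h : u ∈ C
        · have h1 := he u v hu hv h hvC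
          have h2 := he v u hv hu hvC h
          have h3 : e u ≠ p + 1 := fun h3 => hp1 ⟨u, hu, h, h3⟩
          have h4 : e u = p ∨ e u = p - 1 := by omega
          rcases h4 with h3 | h3 <;> simp [h3]
        · simp [h]
    rw [key, sub_sub_cancel, max_eq_right hnonneg]
  · push Not at hp
    have hm : mass x {v | v ∈ C ∧ e v = p} = 0 :=
      mass_eq_zero fun v hv h => hp v hv h.1 h.2
    rw [hm, eq_comm]
    refine max_eq_left (sub_nonpos.2 ?_)
    by_cases hp1 : ∃ w, x w ≠ 0 ∧ w ∈ C ∧ p < e w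
    · obtain ⟨w, hw, hwC, hwp⟩ := hp1
      refine le_trans ?_ (le_abs_self _)
      refine wsum_mono h0 fun u hu => ?_
      by_cases h : u ∈ C
      · have h1 := he w u hw hu hwC h
        have h2 := hp u hu h
        have h3 : p + 1 ≤ e u := by omega
        have h4 : (p : ℝ) + 1 ≤ e u := by exact_mod_cast h3
        simp only [h, Set.indicator_of_mem, Pi.one_apply]
        linarith
      · simp [h]
    · refine le_trans ?_ (neg_le_abs _)
      rw [← wsum_neg]
      refine wsum_mono h0 fun u hu => ?_
      by_cases h : u ∈ C
      · have h2 := hp u hu h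
        have h3 : e u + 1 ≤ p := by
          by_contra h3
          exact hp1 ⟨u, hu, h, by omega⟩
        have h4 : (e u : ℝ) + 1 ≤ p := by exact_mod_cast h3
        simp only [h, Set.indicator_of_mem, Pi.one_apply]
        linarith
      · simp [h]

lemma lineLe_lineCarrier_iff {a b : ℤ} :
    LineLe (lineCarrier a) b ↔ a = 2 * b ∨ b % 2 = 1 ∧ |a - 2 * b| ≤ 2 := by
  rw [abs_le]
  unfold LineLe lineCarrier
  split_ifs <;> omega

namespace Cell

variable {n m : ℕ} (F : Cell n m)

/-- The cell extends in direction `i`. -/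
def Tangent (i : Fin n) : Prop := F.coord i % 2 = 1

/-- The cell lies in a facet of the cube normal to direction `i`. -/
def Side (i : Fin n) : Prop := F.coord i = 0 ∨ F.coord i = 2 * m

variable {F}

lemma Side.not_tangent {i : Fin n} (h : F.Side i) : ¬ F.Tangent i := by
  unfold Side at h
  unfold Tangent
  omega

/-- The displacement of a vertex from the center of `F` in the local model; on the second sheet
the directions normal to the boundary are reversed. -/
noncomputable def displ (F : Cell n m) : Vtx n m → Fin n → ℤ
  | .fine c, i => c.coord i - 2 * F.coord i
  | .coarse Q, i =>
    if F.Side i then (if Q.tag then -1 else 1) * |Q.coord i - F.coord i|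
    else Q.coord i - F.coord i

@[simp] lemma displ_fine (c : Cell n (2 * m)) (i : Fin n) :
    F.displ (.fine c) i = c.coord i - 2 * F.coord i := rfl

lemma displ_coarse (Q : Cell n m) (i : Fin n) : F.displ (.coarse Q) i =
    if F.Side i then (if Q.tag then -1 else 1) * |Q.coord i - F.coord i|
    else Q.coord i - F.coord i := rfl

/-- The point of the local model with given barycentric coordinates. -/
noncomputable def place (F : Cell n m) (x : Vtx n m → ℝ) (i : Fin n) : ℝ :=
  wsum x fun v => (F.displ v i : ℝ)

end Cell

namespace Vtx

variable {n m : ℕ} {F : Cell n m}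

lemma fine_mem_disk_iff {c : Cell n (2 * m)} : fine c ∈ disk F ↔
    (∀ i, c.coord i = 2 * F.coord i ∨ F.Tangent i ∧ |c.coord i - 2 * F.coord i| ≤ 2) ∧
      (c.tag = F.tag ∨ AtBdry (2 * m) c.coord) := by
  rw [fine_mem_disk, Cell.le_def]
  exact and_congr (forall_congr' fun i => lineLe_lineCarrier_iff) (or_congr Iff.rfl
    atBdry_lineCarrier)

lemma fine_mem_diskBdry_iff {c : Cell n (2 * m)} (hc : fine c ∈ disk F) : fine c ∈ diskBdry F ↔
    ∃ i, F.Tangent i ∧ |c.coord i - 2 * F.coord i| = 2 := by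
  have h := (fine_mem_disk_iff.1 hc).1
  rw [fine_mem_diskBdry]
  constructor
  · intro hlt
    by_contra! hne
    have hcoord : F.coord = c.carrier.coord := by
      funext i
      have h1 := h i
      have h2 := hne i
      rw [abs_le] at h1
      rw [Ne, abs_eq (by norm_num)] at h2
      unfold Cell.Tangent at *
      simp only [Cell.carrier, lineCarrier]
      split_ifs <;> omega
    refine hlt.not_ge (Cell.le_def.2 ⟨fun i => Or.inl (congrFun hcoord i), ?_⟩)
    exact hlt.le.2.imp Eq.symm fun h' => hcoord ▸ h'
  · rintro ⟨i, hi, hi'⟩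
    refine lt_of_le_of_ne hc fun heq => ?_
    have : lineCarrier (c.coord i) = F.coord i := congrFun (congrArg Cell.coord heq) i
    rw [abs_eq (by norm_num)] at hi'
    unfold Cell.Tangent at hi
    unfold lineCarrier at this
    split_ifs at this <;> omega

lemma coarse_mem_disk_iff {Q : Cell n m} : coarse Q ∈ disk F ↔
    (∀ i, LineLe (F.coord i) (Q.coord i)) ∧ (F.tag = Q.tag ∨ AtBdry m F.coord) ∧
      ∃ i, Q.coord i ≠ F.coord i := by
  rw [coarse_mem_disk, lt_iff_le_and_ne, Cell.le_def, and_assoc]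
  refine and_congr_right fun h1 => and_congr_right fun h2 => ?_
  constructor
  · intro hne
    by_contra! heq
    have hc : F.coord = Q.coord := funext fun i => (heq i).symm
    refine hne (Cell.ext hc ?_)
    rcases h2 with h2 | h2
    · exact h2
    · rw [F.tag_eq h2, Q.tag_eq (hc ▸ h2)]
  · rintro ⟨i, hi⟩ rfl
    exact hi rfl

lemma fine_le_coarse_of_mem_disk {c : Cell n (2 * m)} {Q : Cell n m} (hc : fine c ∈ disk F)
    (hQ : coarse Q ∈ disk F) : fine c ≤ coarse Q :=
  (fine_mem_disk.1 hc).trans (coarse_mem_disk.1 hQ).le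

lemma fine_le_fine_of_mem_disk {c c' : Cell n (2 * m)} (hc : fine c ∈ disk F)
    (hc' : fine c' ∈ disk F) :
    fine c ≤ fine c' ↔ ∀ i, F.Tangent i → LineLe (c.coord i) (c'.coord i) := by
  rw [fine_le_fine, Cell.le_def]
  rw [fine_mem_disk_iff] at hc hc'
  refine ⟨fun h i _ => h.1 i, fun h => ?_⟩
  have hle : ∀ i, LineLe (c.coord i) (c'.coord i) := fun i => by
    by_cases hi : F.Tangent i
    · exact h i hi
    · left
      have h1 := hc.1 i
      have h2 := hc'.1 i
      simp only [hi, false_and, or_false] at h1 h2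
      rw [h1, h2]
  refine ⟨hle, ?_⟩
  rcases hc.2 with h1 | h1
  · rcases hc'.2 with h2 | h2
    · exact Or.inl (h1.trans h2.symm)
    · exact Or.inr (h2.mono hle)
  · exact Or.inr h1

/-- In a disk at an interior cell all coarse cells lie in the same sheet. -/
lemma tag_eq_of_mem_disk {Q : Cell n m} (hQ : coarse Q ∈ disk F) (hF : ¬ AtBdry m F.coord) :
    Q.tag = F.tag := by
  rcases (coarse_mem_disk_iff.1 hQ).2.1 with h | h
  · exact h.symm
  · exact absurd h hF

/-- A coarse cell of the disk is a boundary cell iff it stays in a facet containing `F`. -/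
lemma atBdry_iff_of_mem_disk {Q : Cell n m} (hQ : coarse Q ∈ disk F) :
    AtBdry m Q.coord ↔ ∃ i, F.Side i ∧ Q.coord i = F.coord i := by
  have h := (coarse_mem_disk_iff.1 hQ).1
  constructor
  · rintro ⟨i, hi⟩
    refine ⟨i, ?_⟩
    have := h i
    unfold LineLe at this
    unfold Cell.Side
    omega
  · rintro ⟨i, hi, hi'⟩
    refine ⟨i, ?_⟩
    unfold Cell.Side at hi
    omega

/-- The order on the coarse cells of a disk. -/
lemma coarse_le_coarse_of_mem_disk {Q Q' : Cell n m} (hQ : coarse Q ∈ disk F)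
    (hQ' : coarse Q' ∈ disk F) : coarse Q ≤ coarse Q' ↔
    (∀ i, Q.coord i ≠ F.coord i → Q'.coord i = Q.coord i) ∧
      (¬ AtBdry m Q.coord → AtBdry m F.coord → ¬ AtBdry m Q'.coord ∧ Q'.tag = Q.tag) := by
  have h := (coarse_mem_disk_iff.1 hQ).1
  have h' := (coarse_mem_disk_iff.1 hQ').1
  rw [coarse_le_coarse, Cell.le_def]
  constructor
  · rintro ⟨h1, h2⟩
    refine ⟨fun i hi => ?_, fun hb _ => ⟨fun hb' => hb (hb'.mono h1), ?_⟩⟩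
    · have h3 := h i
      have h4 := h1 i
      unfold LineLe at *
      omega
    · rcases h2 with h2 | h2
      · exact h2.symm
      · exact absurd h2 hb
  · rintro ⟨h1, h2⟩
    refine ⟨fun i => ?_, ?_⟩
    · by_cases hi : Q.coord i = F.coord i
      · rw [hi]
        exact h' i
      · rw [h1 i hi]
        exact LineLe.refl _
    · by_cases hb : AtBdry m Q.coord
      · exact Or.inr hb
      · by_cases hF : AtBdry m F.coord
        · exact Or.inl (h2 hb hF).2.symm
        · exact Or.inl (by rw [tag_eq_of_mem_disk hQ hF, tag_eq_of_mem_disk hQ' hF])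

end Vtx

namespace Vtx

variable {n m : ℕ} {F : Cell n m} {x : Vtx n m → ℝ}

/-- The weight carried by the fine cells. -/
noncomputable def fineMass (x : Vtx n m → ℝ) : ℝ := mass x (Set.range fine)

/-- The weight carried by the coarse cells. -/
noncomputable def coarseMass (x : Vtx n m → ℝ) : ℝ := mass x (Set.range coarse)

/-- The weight carried by the coarse cells leaving the wall through `F` normal to direction `i`. -/
noncomputable def wallMass (F : Cell n m) (x : Vtx n m → ℝ) (i : Fin n) : ℝ :=
  mass x (coarse '' {Q | Q.coord i ≠ F.coord i})

/-- The weight carried by the coarse cells in the second sheet. -/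
noncomputable def sheetMass (x : Vtx n m → ℝ) : ℝ := mass x (coarse '' {Q | Q.tag = true})

/-- The weight carried by the coarse cells not in the boundary. -/
noncomputable def innerMass (x : Vtx n m → ℝ) : ℝ :=
  mass x (coarse '' {Q | ¬ AtBdry m Q.coord})

@[simp] lemma fine_notMem_coarse_image (c : Cell n (2 * m)) (A : Set (Cell n m)) :
    fine c ∉ coarse '' A := by simp

@[simp] lemma coarse_notMem_fine_image (Q : Cell n m) (A : Set (Cell n (2 * m))) :
    coarse Q ∉ fine '' A := by simp

@[simp] lemma coarse_mem_coarse_image (Q : Cell n m) (A : Set (Cell n m)) :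
    coarse Q ∈ coarse '' A ↔ Q ∈ A := by simp

@[simp] lemma fine_mem_fine_image (c : Cell n (2 * m)) (A : Set (Cell n (2 * m))) :
    fine c ∈ fine '' A ↔ c ∈ A := by simp

lemma fineMass_add_coarseMass (h1 : ∑ v, x v = 1) : fineMass x + coarseMass x = 1 := by
  rw [fineMass, coarseMass, ← mass_union_of_disjoint, ← h1, ← mass_univ]
  · refine mass_congr fun v _ => ?_
    rcases v with c | Q <;> simp
  · rw [Set.disjoint_left]
    rintro _ ⟨c, rfl⟩
    simp

lemma lineLe_of_mem_support (hx : x ∈ (SComplex.orderC (disk F)).realization)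
    {Q Q' : Cell n m} (h : x (coarse Q) ≠ 0) (h' : x (coarse Q') ≠ 0)
    (i : Fin n) :
    LineLe (Q.coord i) (Q'.coord i) ∨ LineLe (Q'.coord i) (Q.coord i) := by
  rw [SComplex.mem_realization_orderC] at hx
  rcases hx.2.2.1.total (x := coarse Q) (y := coarse Q') h h' with h | h
  · exact Or.inl ((coarse_le_coarse.1 h).1 i)
  · exact Or.inr ((coarse_le_coarse.1 h).1 i)

lemma mass_fine_level (hx : x ∈ (SComplex.orderC (disk F)).realization)
    {i : Fin n} (hi : F.Tangent i) (p : ℤ) :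
    mass x (fine '' {c | c.coord i = p}) =
      max 0 (fineMass x - |F.place x i - fineMass x * (p - 2 * F.coord i)|) := by
  have hx' := hx
  rw [SComplex.mem_realization_orderC] at hx'
  obtain ⟨h0, hS, hc, -⟩ := hx'
  have h := mass_level h0 (C := Set.range fine) (e := fun v => F.displ v i) ?_ ?_
    (p - 2 * F.coord i)
  · push_cast at h
    rw [Cell.place, fineMass, ← h]
    refine mass_congr fun v _ => ?_
    rcases v with c | Q
    · simp
    · simp
  · rintro (c | Q) hv hvC
    · simp at hvC
    · have h1 := (coarse_mem_disk_iff.1 (hS _ hv)).1 i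
      have h2 : ¬ F.Side i := fun h => h.not_tangent hi
      simp only [Cell.displ_coarse, h2, if_false]
      unfold Cell.Tangent at hi
      unfold LineLe at h1
      omega
  · rintro _ _ hv hw ⟨c, rfl⟩ ⟨c', rfl⟩
    simp only [Cell.displ_fine]
    rcases hc.total hv hw with h | h
    · have h1 := (fine_le_fine.1 h).1 i
      unfold LineLe at h1
      omega
    · have h1 := (fine_le_fine.1 h).1 i
      unfold LineLe at h1
      omega

lemma displ_fine_eq_zero (hx : x ∈ (SComplex.orderC (disk F)).realization)
    {i : Fin n} (hi : ¬ F.Tangent i) {c : Cell n (2 * m)}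
    (hc : x (fine c) ≠ 0) : F.displ (fine c) i = 0 := by
  rw [SComplex.mem_realization_orderC] at hx
  have h := (fine_mem_disk_iff.1 (hx.2.1 _ hc)).1 i
  simp only [hi, false_and, or_false] at h
  rw [Cell.displ_fine, h, sub_self]

lemma mass_coarse_level (hx : x ∈ (SComplex.orderC (disk F)).realization)
    {i : Fin n} (hi : ¬ F.Tangent i) (hi' : ¬ F.Side i) {p : ℤ}
    (hp : p ≠ F.coord i) :
    mass x (coarse '' {Q | Q.coord i = p}) =
      max 0 (1 - |F.place x i - (p - F.coord i)|) := by
  have hx' := hx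
  rw [SComplex.mem_realization_orderC] at hx'
  obtain ⟨h0, hS, hc, hsum⟩ := hx'
  have h := mass_level h0 (C := Set.univ) (e := fun v => F.displ v i) ?_ ?_ (p - F.coord i)
  · push_cast at h
    rw [mass_univ, hsum, one_mul] at h
    rw [Cell.place, ← h]
    refine mass_congr fun v hv => ?_
    rcases v with c | Q
    · have := displ_fine_eq_zero hx hi hv
      simp only [this, fine_notMem_coarse_image, Set.mem_univ, Set.mem_ofPred_eq, true_and,
        false_iff]
      omega
    · simp [Cell.displ_coarse, hi']
  · exact fun v _ h => absurd (Set.mem_univ v) h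
  · rintro (c | Q) (c' | Q') hv hw - -
    · rw [displ_fine_eq_zero hx hi hv, displ_fine_eq_zero hx hi hw]
      norm_num
    · have h1 := (coarse_mem_disk_iff.1 (hS _ hw)).1 i
      rw [displ_fine_eq_zero hx hi hv]
      simp only [Cell.displ_coarse, hi', if_false]
      unfold LineLe at h1
      omega
    · have h1 := (coarse_mem_disk_iff.1 (hS _ hv)).1 i
      rw [displ_fine_eq_zero hx hi hw]
      simp only [Cell.displ_coarse, hi', if_false]
      unfold LineLe at h1
      omega
    · have h1 := lineLe_of_mem_support hx hv hw i
      simp only [Cell.displ_coarse, hi', if_false]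
      unfold LineLe at h1
      omega

lemma wallMass_eq_abs (hx : x ∈ (SComplex.orderC (disk F)).realization)
    {i : Fin n} (hi : ¬ F.Tangent i) (hi' : ¬ F.Side i) :
    wallMass F x i = |F.place x i| := by
  have hx' := hx
  rw [SComplex.mem_realization_orderC] at hx'
  obtain ⟨h0, hS, hc, hsum⟩ := hx'
  have hnn : 0 ≤ wallMass F x i := mass_nonneg h0 _
  rw [← abs_of_nonneg hnn]
  by_cases hp : ∃ Q, x (coarse Q) ≠ 0 ∧ Q.coord i = F.coord i + 1
  · obtain ⟨Q, hQ, hQi⟩ := hp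
    congr 1
    refine wsum_congr fun v hv => ?_
    rcases v with c | Q'
    · simp [displ_fine_eq_zero hx hi hv, -Cell.displ_fine]
    · have h1 := lineLe_of_mem_support hx hQ hv i
      have h2 := (coarse_mem_disk_iff.1 (hS _ hv)).1 i
      have h3 : Q'.coord i = F.coord i ∨ Q'.coord i = F.coord i + 1 := by
        unfold LineLe at *
        unfold Cell.Tangent at hi
        omega
      rcases h3 with h3 | h3 <;> simp [Cell.displ_coarse, hi', h3]
  · rw [← abs_neg (F.place x i), Cell.place, ← wsum_neg]
    congr 1
    refine wsum_congr fun v hv => ?_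
    rcases v with c | Q'
    · simp [displ_fine_eq_zero hx hi hv, -Cell.displ_fine]
    · have h1 : Q'.coord i ≠ F.coord i + 1 := fun h => hp ⟨Q', hv, h⟩
      have h2 := (coarse_mem_disk_iff.1 (hS _ hv)).1 i
      have h3 : Q'.coord i = F.coord i ∨ Q'.coord i = F.coord i - 1 := by
        unfold LineLe at *
        unfold Cell.Tangent at hi
        omega
      rcases h3 with h3 | h3 <;> simp [Cell.displ_coarse, hi', h3]

lemma place_of_side (hx : x ∈ (SComplex.orderC (disk F)).realization)
    {i : Fin n} (hi : F.Side i) :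
    F.place x i = wallMass F x i - 2 * sheetMass x := by
  have hx' := hx
  rw [SComplex.mem_realization_orderC] at hx'
  obtain ⟨h0, hS, hc, hsum⟩ := hx'
  rw [Cell.place, wallMass, sheetMass, mass, mass, ← wsum_const_mul, ← wsum_sub]
  refine wsum_congr fun v hv => ?_
  rcases v with c | Q
  · simp [displ_fine_eq_zero hx hi.not_tangent hv, -Cell.displ_fine]
  · have h2 := (coarse_mem_disk_iff.1 (hS _ hv)).1 i
    by_cases ht : Q.tag = true
    · have h3 : Q.coord i ≠ F.coord i := fun h => by
        have := Q.tag_eq ((atBdry_iff_of_mem_disk (hS _ hv)).2 ⟨i, hi, h⟩)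
        simp [this] at ht
      have h4 : |Q.coord i - F.coord i| = 1 := by
        unfold LineLe at h2
        rw [abs_eq (by norm_num)]
        omega
      simp [Cell.displ_coarse, hi, ht, h3, h4]
      norm_num
    · by_cases h3 : Q.coord i = F.coord i
      · simp [Cell.displ_coarse, hi, ht, h3]
      · have h4 : |Q.coord i - F.coord i| = 1 := by
          unfold LineLe at h2
          rw [abs_eq (by norm_num)]
          omega
        simp [Cell.displ_coarse, hi, ht, h3, h4]

lemma innerMass_le_wallMass (hx : x ∈ (SComplex.orderC (disk F)).realization)
    {i : Fin n} (hi : F.Side i) : innerMass x ≤ wallMass F x i := by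
  rw [SComplex.mem_realization_orderC] at hx
  obtain ⟨h0, hS, hc, hsum⟩ := hx
  refine mass_mono h0 fun v hv h => ?_
  obtain ⟨Q, hQ, rfl⟩ := h
  exact ⟨Q, fun h => hQ ((atBdry_iff_of_mem_disk (hS _ hv)).2 ⟨i, hi, h⟩), rfl⟩

lemma exists_innerMass_eq_wallMass (hx : x ∈ (SComplex.orderC (disk F)).realization)
    (hF : AtBdry m F.coord) :
    ∃ i, F.Side i ∧ innerMass x = wallMass F x i := by
  have hx' := hx
  rw [SComplex.mem_realization_orderC] at hx'
  obtain ⟨h0, hS, hc, hsum⟩ := hx'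
  suffices ∃ i, F.Side i ∧ ∀ Q, x (coarse Q) ≠ 0 → AtBdry m Q.coord → Q.coord i = F.coord i by
    obtain ⟨i, hi, h⟩ := this
    refine ⟨i, hi, le_antisymm (innerMass_le_wallMass hx hi) (mass_mono h0 fun v hv hv' => ?_)⟩
    obtain ⟨Q, hQ, rfl⟩ := hv'
    exact ⟨Q, fun hb => hQ (h Q hv hb), rfl⟩
  by_cases hne : ∃ Q, x (coarse Q) ≠ 0 ∧ AtBdry m Q.coord
  · obtain ⟨v, ⟨hv, Q, hQ, rfl⟩, htop⟩ := SComplex.exists_top_of_isChain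
      (A := Function.support x ∩ coarse '' {Q | AtBdry m Q.coord})
      (by obtain ⟨Q, h, h'⟩ := hne; exact ⟨coarse Q, h, Q, h', rfl⟩)
      (hc.mono Set.inter_subset_left)
    obtain ⟨i, hi, hi'⟩ := (atBdry_iff_of_mem_disk (hS _ hv)).1 hQ
    refine ⟨i, hi, fun Q' hQ' hb => ?_⟩
    have h1 := (coarse_le_coarse.1 (htop (coarse Q') ⟨hQ', Q', hb, rfl⟩)).1 i
    have h2 := (coarse_mem_disk_iff.1 (hS _ hQ')).1 i
    rw [hi'] at h1
    exact h1.antisymm h2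
  · obtain ⟨i, hi⟩ := hF
    exact ⟨i, hi, fun Q h h' => absurd ⟨Q, h, h'⟩ hne⟩

lemma sheetMass_eq_sheetDepth (hx : x ∈ (SComplex.orderC (disk F)).realization)
    (hF : AtBdry m F.coord) :
    sheetMass x = sheetDepth F.Side (F.place x) := by
  have hx' := hx
  rw [SComplex.mem_realization_orderC] at hx'
  obtain ⟨h0, hS, hc, hsum⟩ := hx'
  obtain ⟨i, hi, hi'⟩ := exists_innerMass_eq_wallMass hx hF
  have hle : sheetMass x ≤ innerMass x := mass_mono h0 fun v _ hv => by
    obtain ⟨Q, hQ, rfl⟩ := hv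
    refine ⟨Q, fun h => ?_, rfl⟩
    have := Q.tag_eq h
    simp_all
  have hnn : 0 ≤ sheetMass x := mass_nonneg h0 _
  refine (sheetDepth_eq hnn (fun j hj => ?_) hi ?_).symm
  · rw [place_of_side hx hj]
    have := innerMass_le_wallMass hx hj
    linarith
  · rw [place_of_side hx hi, ← hi']
    by_cases hs : sheetMass x = 0
    · rw [hs]
      exact le_max_left _ _
    · refine le_trans (le_of_eq ?_) (le_max_right _ _)
      suffices innerMass x = sheetMass x by
        rw [this]
        ring
      have hex : ∃ Q, x (coarse Q) ≠ 0 ∧ Q.tag = true := by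
        by_contra! hne
        refine hs (mass_eq_zero fun v hv hv' => ?_)
        obtain ⟨Q, hQ, rfl⟩ := hv'
        exact hne Q hv hQ
      obtain ⟨Q, hQ, hQt⟩ := hex
      have hQb : ¬ AtBdry m Q.coord := fun h => by
        have := Q.tag_eq h
        simp_all
      refine le_antisymm (mass_mono h0 fun v hv hv' => ?_) hle
      obtain ⟨Q', hQ', rfl⟩ := hv'
      refine ⟨Q', ?_, rfl⟩
      change Q'.tag = true
      rw [← hQt]
      rcases hc.total (x := coarse Q) (y := coarse Q') hQ hv with h | h
      · rcases (coarse_le_coarse.1 h).2 with h | h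
        · exact h.symm
        · exact absurd h hQb
      · rcases (coarse_le_coarse.1 h).2 with h | h
        · exact h
        · exact absurd h hQ'

lemma wallDist_eq_wallMass (hx : x ∈ (SComplex.orderC (disk F)).realization)
    {i : Fin n} (hi : ¬ F.Tangent i) :
    wallDist F.Tangent F.Side (F.place x) i = wallMass F x i := by
  by_cases hs : F.Side i
  · simp only [wallDist, hi, hs, if_true, if_false]
    rw [← sheetMass_eq_sheetDepth hx ⟨i, hs⟩, place_of_side hx hs]
    ring
  · simp only [wallDist, hi, hs, if_false]
    exact (wallMass_eq_abs hx hi hs).symm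

lemma norm_wallDist_eq_coarseMass (hx : x ∈ (SComplex.orderC (disk F)).realization) :
    ‖wallDist F.Tangent F.Side (F.place x)‖ = coarseMass x := by
  have hx' := hx
  rw [SComplex.mem_realization_orderC] at hx'
  obtain ⟨h0, hS, hc, hsum⟩ := hx'
  have hs : 0 ≤ coarseMass x := mass_nonneg h0 _
  refine le_antisymm ((pi_norm_le_iff_of_nonneg hs).2 fun i => ?_) ?_
  · rw [Real.norm_of_nonneg (wallDist_nonneg _ i)]
    by_cases hi : F.Tangent i
    · simpa [wallDist, hi]
    · rw [wallDist_eq_wallMass hx hi]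
      refine mass_mono h0 fun v _ hv => ?_
      obtain ⟨Q, -, rfl⟩ := hv
      exact ⟨Q, rfl⟩
  · by_cases hne : ∃ Q, x (coarse Q) ≠ 0
    · obtain ⟨v, ⟨hv, Q, rfl⟩, hbot⟩ := SComplex.exists_bot_of_isChain
        (A := Function.support x ∩ Set.range coarse)
        (by obtain ⟨Q, h⟩ := hne; exact ⟨coarse Q, h, Q, rfl⟩) (hc.mono Set.inter_subset_left)
      obtain ⟨h1, -, i, hi⟩ := coarse_mem_disk_iff.1 (hS _ hv)
      have hT : ¬ F.Tangent i := by
        have := h1 i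
        unfold LineLe at this
        unfold Cell.Tangent
        omega
      refine le_trans ?_ (wallDist_le_norm _ i)
      rw [wallDist_eq_wallMass hx hT]
      refine mass_mono h0 fun v hv' hv'' => ?_
      obtain ⟨Q', rfl⟩ := hv''
      refine ⟨Q', ?_, rfl⟩
      have h2 := (coarse_le_coarse.1 (hbot _ ⟨hv', Q', rfl⟩)).1 i
      have h3 := h1 i
      change Q'.coord i ≠ F.coord i
      unfold LineLe at *
      omega
    · refine le_trans (le_of_eq ?_) (norm_nonneg _)
      refine mass_eq_zero fun v hv hv' => ?_
      obtain ⟨Q, rfl⟩ := hv'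
      exact hne ⟨Q, hv⟩

end Vtx

namespace Vtx

variable {n m : ℕ} {F : Cell n m} {x y : Vtx n m → ℝ}

lemma displ_coarse_eq_zero {i : Fin n} (hi : F.Tangent i) {Q : Cell n m}
    (hQ : coarse Q ∈ disk F) : F.displ (coarse Q) i = 0 := by
  have h1 := (coarse_mem_disk_iff.1 hQ).1 i
  have h2 : ¬ F.Side i := fun h => h.not_tangent hi
  simp only [Cell.displ_coarse, h2, if_false]
  unfold Cell.Tangent at hi
  unfold LineLe at h1
  omega

/-- A set of vertices on which the tangential displacement is not extremal bounds the displacement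
away from its extreme value. -/
lemma abs_place_add_mass_le (hx : x ∈ (SComplex.orderC (disk F)).realization) {i : Fin n}
    (hi : F.Tangent i) {A : Set (Cell n (2 * m))}
    (hA : ∀ c ∈ A, |c.coord i - 2 * F.coord i| ≤ 1) :
    |F.place x i| + mass x (fine '' A) ≤ 2 * fineMass x := by
  rw [SComplex.mem_realization_orderC] at hx
  obtain ⟨h0, hS, hc, hsum⟩ := hx
  have key : ∀ σ : ℝ, |σ| = 1 → σ * F.place x i + mass x (fine '' A) ≤ 2 * fineMass x := by
    intro σ hσ
    rw [Cell.place, fineMass, mass, mass, ← wsum_const_mul, ← wsum_const_mul, ← wsum_add]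
    refine wsum_mono h0 fun v hv => ?_
    rcases v with c | Q
    · have h1 : σ * ((F.displ (fine c) i : ℤ) : ℝ) ≤ (|c.coord i - 2 * F.coord i| : ℤ) := by
        rw [Int.cast_abs]
        refine (le_abs_self _).trans ?_
        rw [abs_mul, hσ, one_mul, Cell.displ_fine]
      have h2 : |c.coord i - 2 * F.coord i| ≤ 2 := by
        rcases (fine_mem_disk_iff.1 (hS _ hv)).1 i with h | h
        · simp [h]
        · exact h.2
      by_cases hcA : c ∈ A
      · have h3 : ((|c.coord i - 2 * F.coord i| : ℤ) : ℝ) ≤ 1 := by exact_mod_cast hA c hcA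
        rw [Set.indicator_of_mem (by simpa using hcA), Set.indicator_of_mem (by simp)]
        simp only [Pi.one_apply]
        linarith
      · have h3 : ((|c.coord i - 2 * F.coord i| : ℤ) : ℝ) ≤ 2 := by exact_mod_cast h2
        rw [Set.indicator_of_notMem (by simpa using hcA), Set.indicator_of_mem (by simp)]
        simp only [Pi.one_apply]
        linarith
    · rw [displ_coarse_eq_zero hi (hS _ hv), Set.indicator_of_notMem (by simp),
        Set.indicator_of_notMem (by simp)]
      simp
  have h1 := key 1 (by simp)
  have h2 := key (-1) (by simp)
  rcases abs_choice (F.place x i) with h | h <;> rw [h] <;> linarith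

lemma norm_tangentPart_le (hx : x ∈ (SComplex.orderC (disk F)).realization) :
    ‖tangentPart F.Tangent (F.place x)‖ ≤ 2 * fineMass x := by
  have h0 := ((SComplex.mem_realization_orderC).1 hx).1
  have hf : 0 ≤ fineMass x := mass_nonneg h0 _
  refine (pi_norm_le_iff_of_nonneg (by positivity)).2 fun i => ?_
  unfold tangentPart
  split_ifs with hi
  · have := abs_place_add_mass_le hx hi (A := ∅) (by simp)
    have h1 := mass_nonneg h0 (fine '' (∅ : Set (Cell n (2 * m))))
    rw [Real.norm_eq_abs]
    linarith
  · simpa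

lemma cellGauge_place (hx : x ∈ (SComplex.orderC (disk F)).realization) :
    cellGauge F.Tangent F.Side (F.place x) =
      1 - (fineMass x - ‖tangentPart F.Tangent (F.place x)‖ / 2) := by
  have h := fineMass_add_coarseMass ((SComplex.mem_realization_orderC).1 hx).2.2.2
  rw [cellGauge, norm_wallDist_eq_coarseMass hx]
  linarith

lemma cellGauge_place_le_one (hx : x ∈ (SComplex.orderC (disk F)).realization) :
    cellGauge F.Tangent F.Side (F.place x) ≤ 1 := by
  rw [cellGauge_place hx]
  linarith [norm_tangentPart_le hx]

lemma mem_bdry_iff_cellGauge_place (hx : x ∈ (SComplex.orderC (disk F)).realization) :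
    x ∈ (SComplex.orderC (diskBdry F)).realization ↔
      cellGauge F.Tangent F.Side (F.place x) = 1 := by
  have hx' := hx
  rw [SComplex.mem_realization_orderC] at hx'
  obtain ⟨h0, hS, hc, hsum⟩ := hx'
  have hle := norm_tangentPart_le hx
  rw [cellGauge_place hx, SComplex.mem_realization_orderC]
  constructor
  · rintro ⟨-, hS', -, -⟩
    suffices 2 * fineMass x ≤ ‖tangentPart F.Tangent (F.place x)‖ by linarith
    by_cases hne : ∃ c, x (fine c) ≠ 0
    · obtain ⟨v, ⟨hv, c, rfl⟩, htop⟩ := SComplex.exists_top_of_isChain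
        (A := Function.support x ∩ Set.range fine)
        (by obtain ⟨c, h⟩ := hne; exact ⟨fine c, h, c, rfl⟩) (hc.mono Set.inter_subset_left)
      obtain ⟨i, hi, hi'⟩ := (fine_mem_diskBdry_iff (hS _ hv)).1 (hS' _ hv)
      have hz : F.place x i = (c.coord i - 2 * F.coord i : ℤ) * fineMass x := by
        rw [Cell.place, fineMass, mass, ← wsum_const_mul]
        refine wsum_congr fun v hv' => ?_
        rcases v with c' | Q
        · have h1 := (fine_le_fine.1 (htop _ ⟨hv', c', rfl⟩)).1 i
          have h2 : c'.coord i = c.coord i := by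
            rw [abs_eq (by norm_num)] at hi'
            unfold LineLe at h1
            omega
          rw [Set.indicator_of_mem (by simp), Cell.displ_fine, h2]
          simp
        · rw [displ_coarse_eq_zero hi (hS _ hv'), Set.indicator_of_notMem (by simp)]
          simp
      have h1 := norm_le_pi_norm (tangentPart F.Tangent (F.place x)) i
      simp only [tangentPart, hi, if_true] at h1
      have hf : 0 ≤ fineMass x := mass_nonneg h0 _
      rw [hz, norm_mul, Real.norm_eq_abs, ← Int.cast_abs, hi', Real.norm_of_nonneg hf] at h1
      exact_mod_cast h1
    · have : fineMass x = 0 := mass_eq_zero fun v hv hv' => by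
        obtain ⟨c, rfl⟩ := hv'
        exact hne ⟨c, hv⟩
      rw [this, mul_zero]
      exact norm_nonneg _
  · intro hG
    refine ⟨h0, fun v hv => ?_, hc, hsum⟩
    rcases v with c | Q
    · by_contra hcb
      have hc1 := fine_mem_diskBdry_iff (hS _ hv)
      have hc2 := fine_mem_disk_iff.1 (hS _ hv)
      have hpos : 0 < mass x (fine '' {c}) := mass_pos h0 hv (by simp)
      have hfpos : 0 < fineMass x := mass_pos h0 hv (by simp)
      have hlt : ‖tangentPart F.Tangent (F.place x)‖ < 2 * fineMass x := by
        refine (pi_norm_lt_iff (by positivity)).2 fun i => ?_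
        unfold tangentPart
        split_ifs with hi
        · have h1 := abs_place_add_mass_le hx hi (A := {c}) (by
            intro c' hc'
            rw [Set.mem_singleton_iff.1 hc']
            have h2 : |c.coord i - 2 * F.coord i| ≠ 2 := fun h => hcb (hc1.2 ⟨i, hi, h⟩)
            rcases hc2.1 i with h | h
            · simp [h]
            · have := h.2
              omega)
          rw [Real.norm_eq_abs]
          linarith
        · simpa
      linarith
    · exact hS _ hv

lemma mass_fine_lineLe_eq (hx : x ∈ (SComplex.orderC (disk F)).realization)
    (hy : y ∈ (SComplex.orderC (disk F)).realization) (h : F.place x = F.place y)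
    (hf : fineMass x = fineMass y) {i : Fin n} (hi : F.Tangent i) (p : ℤ) :
    mass x (fine '' {c | LineLe p (c.coord i)}) = mass y (fine '' {c | LineLe p (c.coord i)}) := by
  have hlev : ∀ q : ℤ, mass x (fine '' {c | c.coord i = q}) =
      mass y (fine '' {c | c.coord i = q}) := fun q => by
    rw [mass_fine_level hx hi, mass_fine_level hy hi, h, hf]
  by_cases hp : p % 2 = 1
  · have hset : ∀ c : Cell n (2 * m), LineLe p (c.coord i) ↔ c.coord i = p := fun c => by
      unfold LineLe
      omega
    simp only [hset, hlev]
  · have hset : (fine '' {c : Cell n (2 * m) | LineLe p (c.coord i)} : Set (Vtx n m)) =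
        fine '' {c | c.coord i = p} ∪
          (fine '' {c | c.coord i = p + 1} ∪ fine '' {c | c.coord i = p - 1}) := by
      rw [← Set.image_union, ← Set.image_union]
      congr 1
      ext c
      simp only [Set.mem_union, Set.mem_ofPred_eq, LineLe]
      omega
    have hd : ∀ {q r : ℤ}, q ≠ r → Disjoint (fine '' {c : Cell n (2 * m) | c.coord i = q})
        (fine '' {c : Cell n (2 * m) | c.coord i = r} : Set (Vtx n m)) := fun hqr => by
      rw [Set.disjoint_left]
      rintro _ ⟨c, hc, rfl⟩ hc'
      rw [fine_mem_fine_image] at hc'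
      exact hqr (hc.symm.trans hc')
    have hd1 : (p : ℤ) ≠ p + 1 := by omega
    have hd2 : (p : ℤ) ≠ p - 1 := by omega
    have hd3 : (p : ℤ) + 1 ≠ p - 1 := by omega
    have hd4 := Set.disjoint_union_right.2 ⟨hd hd1, hd hd2⟩
    rw [hset, mass_union_of_disjoint x hd4, mass_union_of_disjoint y hd4,
      mass_union_of_disjoint x (hd hd3), mass_union_of_disjoint y (hd hd3), hlev, hlev, hlev]

lemma wallMass_eq (hx : x ∈ (SComplex.orderC (disk F)).realization)
    (hy : y ∈ (SComplex.orderC (disk F)).realization) (h : F.place x = F.place y)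
    {i : Fin n} (hi : ¬ F.Tangent i) : wallMass F x i = wallMass F y i := by
  rw [← wallDist_eq_wallMass hx hi, ← wallDist_eq_wallMass hy hi, h]

lemma innerMass_le (hx : x ∈ (SComplex.orderC (disk F)).realization)
    (hy : y ∈ (SComplex.orderC (disk F)).realization) (h : F.place x = F.place y)
    (hF : AtBdry m F.coord) : innerMass x ≤ innerMass y := by
  obtain ⟨i, hi, hi'⟩ := exists_innerMass_eq_wallMass hy hF
  rw [hi', ← wallMass_eq hx hy h hi.not_tangent]
  exact innerMass_le_wallMass hx hi

lemma mass_sheet_eq (hx : x ∈ (SComplex.orderC (disk F)).realization)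
    (hy : y ∈ (SComplex.orderC (disk F)).realization) (h : F.place x = F.place y)
    (hF : AtBdry m F.coord) (b : Bool) :
    mass x (coarse '' {Q | ¬ AtBdry m Q.coord ∧ Q.tag = b}) =
      mass y (coarse '' {Q | ¬ AtBdry m Q.coord ∧ Q.tag = b}) := by
  have hs : sheetMass x = sheetMass y := by
    rw [sheetMass_eq_sheetDepth hx hF, sheetMass_eq_sheetDepth hy hF, h]
  have htrue : (coarse '' {Q : Cell n m | ¬ AtBdry m Q.coord ∧ Q.tag = true} : Set (Vtx n m)) =
      coarse '' {Q | Q.tag = true} := by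
    congr 1
    ext Q
    refine ⟨fun h => h.2, fun h => ⟨fun hb => ?_, h⟩⟩
    have h1 : Q.tag = true := h
    rw [Q.tag_eq hb] at h1
    exact absurd h1 (by simp)
  cases b
  · have hsplit : ∀ w : Vtx n m → ℝ, innerMass w =
        mass w (coarse '' {Q | ¬ AtBdry m Q.coord ∧ Q.tag = false}) + sheetMass w := fun w => by
      rw [sheetMass, ← htrue, ← mass_union_of_disjoint, innerMass, ← Set.image_union]
      · congr 2
        ext Q
        cases hQ : Q.tag <;> simp [hQ]
      · rw [Set.disjoint_left]
        rintro _ ⟨Q, hQ, rfl⟩ hQ'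
        rw [coarse_mem_coarse_image] at hQ'
        have := hQ.2.symm.trans hQ'.2
        simp at this
    have h1 := hsplit x
    have h2 := hsplit y
    have h3 := le_antisymm (innerMass_le hx hy h hF) (innerMass_le hy hx h.symm hF)
    linarith
  · rw [htrue]
    exact hs

lemma mass_coarse_level_eq (hx : x ∈ (SComplex.orderC (disk F)).realization)
    (hy : y ∈ (SComplex.orderC (disk F)).realization) (h : F.place x = F.place y)
    {Q : Cell n m} (hQ : coarse Q ∈ disk F) {i : Fin n} (hi : Q.coord i ≠ F.coord i) :
    mass x (coarse '' {Q' | Q'.coord i = Q.coord i}) =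
      mass y (coarse '' {Q' | Q'.coord i = Q.coord i}) := by
  have hT : ¬ F.Tangent i := by
    have := (coarse_mem_disk_iff.1 hQ).1 i
    unfold LineLe at this
    unfold Cell.Tangent
    omega
  by_cases hs : F.Side i
  · have hw : ∀ {w : Vtx n m → ℝ}, w ∈ (SComplex.orderC (disk F)).realization →
        mass w (coarse '' {Q' | Q'.coord i = Q.coord i}) = wallMass F w i := fun {w} hw => by
      refine mass_congr fun v hv => ?_
      rcases v with c | Q'
      · simp
      · rw [coarse_mem_coarse_image, coarse_mem_coarse_image]
        have h1 := (coarse_mem_disk_iff.1 hQ).1 i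
        have h2 := (coarse_mem_disk_iff.1 (((SComplex.mem_realization_orderC).1 hw).2.1 _ hv)).1 i
        have h3 := Q.mem_range i
        have h4 := Q'.mem_range i
        change Q'.coord i = Q.coord i ↔ Q'.coord i ≠ F.coord i
        unfold LineLe at *
        unfold Cell.Side at hs
        omega
    rw [hw hx, hw hy, wallMass_eq hx hy h hT]
  · rw [mass_coarse_level hx hT hs hi, mass_coarse_level hy hT hs hi, h]

lemma eq_of_place_eq (hx : x ∈ (SComplex.orderC (disk F)).realization)
    (hy : y ∈ (SComplex.orderC (disk F)).realization) (h : F.place x = F.place y) : x = y := by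
  have hs : coarseMass x = coarseMass y := by
    rw [← norm_wallDist_eq_coarseMass hx, ← norm_wallDist_eq_coarseMass hy, h]
  have hf : fineMass x = fineMass y := by
    have h1 := fineMass_add_coarseMass ((SComplex.mem_realization_orderC).1 hx).2.2.2
    have h2 := fineMass_add_coarseMass ((SComplex.mem_realization_orderC).1 hy).2.2.2
    linarith
  refine SComplex.eq_of_mass_eq hx hy fun v hv => ?_
  rcases v with e | Q
  · refine ⟨{C | ∃ i, F.Tangent i ∧
      C = Set.range coarse ∪ fine '' {c | LineLe (e.coord i) (c.coord i)}}, ?_, ?_, ?_⟩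
    · rintro _ ⟨i, hi, rfl⟩ (c | Q) ha (c' | Q') hb hmem hab
      · right
        rcases hmem with hmem | hmem
        · simp at hmem
        rw [fine_mem_fine_image] at hmem ⊢
        exact LineLe.trans hmem ((fine_le_fine.1 hab).1 i)
      · simp
      · exact absurd hab not_coarse_le_fine
      · simp
    · rintro (c | Q) ha
      · rw [fine_le_fine_of_mem_disk hv ha]
        constructor
        · rintro hle _ ⟨i, hi, rfl⟩
          exact Or.inr ⟨c, hle i hi, rfl⟩
        · intro hall i hi
          rcases hall _ ⟨i, hi, rfl⟩ with h' | h'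
          · simp at h'
          · exact (fine_mem_fine_image _ _).1 h'
      · refine iff_of_true (fine_le_coarse_of_mem_disk hv ha) ?_
        rintro _ ⟨i, hi, rfl⟩
        simp
    · rintro _ ⟨i, hi, rfl⟩
      have hd : Disjoint (Set.range (coarse (n := n) (m := m)))
          (fine '' {c | LineLe (e.coord i) (c.coord i)}) := by
        rw [Set.disjoint_left]
        rintro _ ⟨Q, rfl⟩
        simp
      rw [mass_union_of_disjoint x hd, mass_union_of_disjoint y hd,
        mass_fine_lineLe_eq hx hy h hf hi]
      exact congrArg (· + _) hs
  · refine ⟨{C | (∃ i, Q.coord i ≠ F.coord i ∧ C = coarse '' {Q' | Q'.coord i = Q.coord i}) ∨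
      (¬ AtBdry m Q.coord ∧ AtBdry m F.coord ∧
        C = coarse '' {Q' | ¬ AtBdry m Q'.coord ∧ Q'.tag = Q.tag})}, ?_, ?_, ?_⟩
    · rintro _ (⟨i, hi, rfl⟩ | ⟨hQ, hF, rfl⟩) _ ha (c' | Q'') hb ⟨Q', hQ', rfl⟩ hab
      · exact absurd hab not_coarse_le_fine
      · have hQi : Q'.coord i = Q.coord i := hQ'
        refine ⟨Q'', ?_, rfl⟩
        rw [coarse_le_coarse_of_mem_disk ha hb] at hab
        exact (hab.1 i (by rwa [hQi])).trans hQi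
      · exact absurd hab not_coarse_le_fine
      · refine ⟨Q'', ?_, rfl⟩
        rw [coarse_le_coarse_of_mem_disk ha hb] at hab
        obtain ⟨h1, h2⟩ := hab.2 hQ'.1 hF
        exact ⟨h1, h2.trans hQ'.2⟩
    · rintro (c | Q') ha
      · refine iff_of_false not_coarse_le_fine fun hall => ?_
        obtain ⟨i, hi⟩ := (coarse_mem_disk_iff.1 hv).2.2
        exact fine_notMem_coarse_image _ _ (hall _ (Or.inl ⟨i, hi, rfl⟩))
      · rw [coarse_le_coarse_of_mem_disk hv ha]
        constructor
        · rintro ⟨h1, h2⟩ _ (⟨i, hi, rfl⟩ | ⟨hQ, hF, rfl⟩)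
          · exact ⟨Q', h1 i hi, rfl⟩
          · exact ⟨Q', h2 hQ hF, rfl⟩
        · intro hall
          exact ⟨fun i hi => (coarse_mem_coarse_image _ _).1 (hall _ (Or.inl ⟨i, hi, rfl⟩)),
            fun hQ hF => (coarse_mem_coarse_image _ _).1 (hall _ (Or.inr ⟨hQ, hF, rfl⟩))⟩
    · rintro _ (⟨i, hi, rfl⟩ | ⟨hQ, hF, rfl⟩)
      · exact mass_coarse_level_eq hx hy h hv hi
      · exact mass_sheet_eq hx hy h hF _

end Vtx

/-! ### Surjectivity of the local model -/

section Path

variable {n m : ℕ}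

/-- The fine cell at height `t` over the point `z` of the local model, for `t` less than the total
weight `f` of the fine cells. -/
noncomputable def finePath (F : Cell n m) (z : Fin n → ℝ) (f t : ℝ) : Cell n (2 * m) :=
  let o : Fin n → ℤ := fun i => if 0 ≤ z i then 1 else -1
  let e : Fin n → ℤ := fun i => 2 * F.coord i + if F.Tangent i then
    o i + (if t < |z i - f * o i| then (if f * o i ≤ z i then 1 else -1) else 0) else 0
  { coord := e
    tag := if AtBdry (2 * m) e then false else F.tag
    mem_range := fun i => by
      have h := F.mem_range i
      simp only [e, o, Cell.Tangent]
      push_cast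
      split_ifs <;> omega
    tag_eq := fun h => if_pos h }

/-- The coarse cell at height `t` over the point `z` of the local model. -/
noncomputable def coarsePath (hm : 0 < m) (F : Cell n m) (z : Fin n → ℝ) (t : ℝ) : Cell n m :=
  let e : Fin n → ℤ := fun i => F.coord i +
    if ¬ F.Tangent i ∧ 1 - wallDist F.Tangent F.Side z i ≤ t then
      (if F.Side i then (if F.coord i = 0 then 1 else -1) else (if 0 ≤ z i then 1 else -1)) else 0
  { coord := e
    tag := if AtBdry m e then false else
      if AtBdry m F.coord then decide (0 < sheetDepth F.Side z) else F.tag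
    mem_range := fun i => by
      have h := F.mem_range i
      simp only [e, Cell.Tangent, Cell.Side]
      split_ifs <;> omega
    tag_eq := fun h => if_pos h }

variable {F : Cell n m} {z : Fin n → ℝ} {f t t' : ℝ}

lemma fine_finePath_mem_disk : Vtx.fine (finePath F z f t) ∈ Vtx.disk F := by
  refine Vtx.fine_mem_disk_iff.2 ⟨fun i => ?_, ?_⟩
  · by_cases hi : F.Tangent i
    · refine Or.inr ⟨hi, ?_⟩
      rw [abs_le]
      simp only [finePath, hi, if_true]
      split_ifs <;> omega
    · left
      simp [finePath, hi]
  · by_cases h : AtBdry (2 * m) (finePath F z f t).coord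
    · exact Or.inr h
    · exact Or.inl (if_neg h)

lemma finePath_mono (htt' : t ≤ t') :
    Vtx.fine (finePath F z f t) ≤ Vtx.fine (finePath F z f t') := by
  rw [Vtx.fine_le_fine_of_mem_disk fine_finePath_mem_disk fine_finePath_mem_disk]
  intro i hi
  simp only [finePath, hi, if_true]
  by_cases h : t' < |z i - f * (if 0 ≤ z i then 1 else -1 : ℤ)|
  · rw [if_pos h, if_pos (htt'.trans_lt h)]
    exact LineLe.refl _
  · rw [if_neg h]
    unfold LineLe
    split_ifs <;> omega

variable {hm : 0 < m}

lemma lineLe_coarsePath (i : Fin n) : LineLe (F.coord i) ((coarsePath hm F z t).coord i) := by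
  simp only [coarsePath, LineLe, Cell.Tangent]
  split_ifs <;> omega

lemma coord_coarsePath_of_lt {i : Fin n} (h : t < 1 - wallDist F.Tangent F.Side z i) :
    (coarsePath hm F z t).coord i = F.coord i := by
  simp only [coarsePath, not_le.2 h, and_false, if_false, add_zero]

lemma coarsePath_mono (htt' : t ≤ t') :
    Vtx.coarse (coarsePath hm F z t) ≤ Vtx.coarse (coarsePath hm F z t') := by
  have hle : ∀ i, LineLe ((coarsePath hm F z t).coord i) ((coarsePath hm F z t').coord i) := by
    intro i
    by_cases h : 1 - wallDist F.Tangent F.Side z i ≤ t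
    · left
      simp only [coarsePath, h, h.trans htt']
    · rw [coord_coarsePath_of_lt (not_le.1 h)]
      exact lineLe_coarsePath i
  refine Vtx.coarse_le_coarse.2 (Cell.le_def.2 ⟨hle, ?_⟩)
  by_cases h : AtBdry m (coarsePath hm F z t).coord
  · exact Or.inr h
  · exact Or.inl ((if_neg h).trans (if_neg fun h' => h (h'.mono hle)).symm)

lemma coarse_coarsePath_mem_disk (ht : t < 1)
    (ht' : 1 - ‖wallDist F.Tangent F.Side z‖ ≤ t) :
    Vtx.coarse (coarsePath hm F z t) ∈ Vtx.disk F := by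
  refine Vtx.coarse_mem_disk_iff.2 ⟨lineLe_coarsePath, ?_, ?_⟩
  · by_cases h : AtBdry m F.coord
    · exact Or.inr h
    · left
      have h' : ¬ AtBdry m (coarsePath hm F z t).coord := fun h' => h (h'.mono lineLe_coarsePath)
      exact ((if_neg h').trans (if_neg h)).symm
  · by_contra! hne
    have hlt : ‖wallDist F.Tangent F.Side z‖ < 1 - t := by
      refine (pi_norm_lt_iff (by linarith)).2 fun i => ?_
      rw [Real.norm_of_nonneg (wallDist_nonneg _ i)]
      by_cases hi : F.Tangent i
      · simp only [wallDist, hi, if_true]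
        linarith
      · by_contra hle
        have h1 : 1 - wallDist F.Tangent F.Side z i ≤ t := by linarith
        have h2 := hne i
        simp only [coarsePath, hi, h1, not_false_eq_true, and_self, if_true] at h2
        split_ifs at h2 <;> omega
    linarith

lemma displ_finePath_of_not_tangent {i : Fin n} (hi : ¬ F.Tangent i) :
    F.displ (Vtx.fine (finePath F z f t)) i = 0 := by
  simp [finePath, hi]

lemma displ_coarsePath_of_not_side {i : Fin n} (hi : ¬ F.Tangent i) (hi' : ¬ F.Side i) :
    (F.displ (Vtx.coarse (coarsePath hm F z t)) i : ℝ) =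
      (if 0 ≤ z i then 1 else -1) * (1 - (if t < 1 - |z i| then 1 else 0)) := by
  by_cases h : 1 - |z i| ≤ t
  · have h' := not_lt.2 h
    simp only [Cell.displ_coarse, coarsePath, hi, hi', h, h', wallDist, if_false,
      not_false_eq_true, and_self, if_true]
    split_ifs <;> simp
  · have h' : t < 1 - wallDist F.Tangent F.Side z i := by
      simpa only [wallDist, hi, hi', if_false] using not_le.1 h
    simp only [Cell.displ_coarse, coord_coarsePath_of_lt h', not_le.1 h, hi', if_true, if_false]
    simp

lemma atBdry_coarsePath (hw : 0 < sheetDepth F.Side z) :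
    AtBdry m (coarsePath hm F z t).coord ↔ t < 1 - sheetDepth F.Side z := by
  constructor
  · rintro ⟨i, hi⟩
    have h1 := lineLe_coarsePath (hm := hm) (F := F) (z := z) (t := t) i
    have hs : F.Side i ∧ (coarsePath hm F z t).coord i = F.coord i := by
      unfold LineLe at h1
      unfold Cell.Side
      omega
    obtain ⟨hs, hs'⟩ := hs
    by_contra hle
    have h2 := sheetDepth_le_wallDist hs.not_tangent hs z
    have h3 : 1 - wallDist F.Tangent F.Side z i ≤ t := by linarith
    simp only [coarsePath, hs.not_tangent, hs, h3, not_false_eq_true, and_self, if_true] at hs'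
    split_ifs at hs' <;> omega
  · intro h
    obtain ⟨i, hi, hi'⟩ := exists_neg_of_sheetDepth_pos hw
    refine ⟨i, ?_⟩
    have h1 : wallDist F.Tangent F.Side z i = sheetDepth F.Side z := by
      simp only [wallDist, hi.not_tangent, hi, if_true, if_false]
      linarith
    rw [coord_coarsePath_of_lt (by rwa [h1])]
    exact hi

lemma tag_coarsePath (ht : t < 1) (hF : AtBdry m F.coord) :
    (coarsePath hm F z t).tag = true ↔ ¬ t < 1 - sheetDepth F.Side z := by
  by_cases hw : 0 < sheetDepth F.Side z
  · rw [← atBdry_coarsePath (hm := hm) hw]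
    by_cases h : AtBdry m (coarsePath hm F z t).coord
    · have : (coarsePath hm F z t).tag = false := if_pos h
      simp [this, h]
    · have : (coarsePath hm F z t).tag = true :=
        (if_neg h).trans ((if_pos hF).trans (decide_eq_true hw))
      simp [this, h]
  · have h0 : sheetDepth F.Side z = 0 := le_antisymm (not_lt.1 hw) (sheetDepth_nonneg z)
    have : (coarsePath hm F z t).tag = false := by
      by_cases h : AtBdry m (coarsePath hm F z t).coord
      · exact if_pos h
      · exact (if_neg h).trans ((if_pos hF).trans (decide_eq_false hw))
    simp [this, h0, ht]

lemma displ_coarsePath_of_side (ht : t < 1) {i : Fin n} (hi : F.Side i) :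
    (F.displ (Vtx.coarse (coarsePath hm F z t)) i : ℝ) =
      -1 + -1 * (if t < 1 - wallDist F.Tangent F.Side z i then 1 else 0) +
        2 * (if t < 1 - sheetDepth F.Side z then 1 else 0) := by
  have hle := sheetDepth_le_wallDist hi.not_tangent hi z
  have htag := tag_coarsePath (hm := hm) (z := z) ht ⟨i, hi⟩
  by_cases h : t < 1 - wallDist F.Tangent F.Side z i
  · have h1 : (coarsePath hm F z t).coord i = F.coord i := coord_coarsePath_of_lt h
    have h2 : t < 1 - sheetDepth F.Side z := by linarith
    simp only [Cell.displ_coarse, hi, h1, h, h2, if_true]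
    norm_num
  · have h1 : |(coarsePath hm F z t).coord i - F.coord i| = 1 := by
      rw [abs_eq (by norm_num)]
      simp only [coarsePath, hi, hi.not_tangent, not_lt.1 h, not_false_eq_true, and_self, if_true]
      split_ifs <;> omega
    by_cases h2 : t < 1 - sheetDepth F.Side z
    · have h3 : ¬ (coarsePath hm F z t).tag = true := fun h3 => htag.1 h3 h2
      simp only [Cell.displ_coarse, hi, h1, h, h2, h3, if_true]
      norm_num
    · have h3 : (coarsePath hm F z t).tag = true := htag.2 h2
      simp only [Cell.displ_coarse, hi, h1, h, h2, h3, if_true]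
      norm_num

end Path

namespace Vtx

variable {n m : ℕ} {F : Cell n m}

lemma exists_place_eq (hm : 0 < m) {z : Fin n → ℝ} (hz : cellGauge F.Tangent F.Side z ≤ 1) :
    ∃ x ∈ (SComplex.orderC (disk F)).realization, F.place x = z := by
  set s := ‖wallDist F.Tangent F.Side z‖ with hs
  have hs0 : 0 ≤ s := norm_nonneg _
  have ha0 := norm_nonneg (tangentPart F.Tangent z)
  have ha : ‖tangentPart F.Tangent z‖ ≤ 2 * (1 - s) := by
    unfold cellGauge at hz
    linarith
  have hu : ∀ i, wallDist F.Tangent F.Side z i ≤ s := wallDist_le_norm z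
  obtain ⟨x, hx, h_integral⟩ := SComplex.exists_realization_of_path (S := disk F)
    (fun t => if t < 1 - s then fine (finePath F z (1 - s) t) else coarse (coarsePath hm F z t))
    (fun t ht => by
      split_ifs with h
      · exact fine_finePath_mem_disk
      · exact coarse_coarsePath_mem_disk ht.2 (not_lt.1 h))
    (fun t ht t' ht' htt' => by
      simp only
      split_ifs with h h' h'
      · exact finePath_mono htt'
      · exact fine_le_coarse_of_mem_disk fine_finePath_mem_disk
          (coarse_coarsePath_mem_disk ht'.2 (not_lt.1 h'))
      · exact absurd (htt'.trans_lt h') h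
      · exact coarsePath_mono htt')
  refine ⟨x, hx, funext fun i => ?_⟩
  rw [Cell.place, h_integral]
  by_cases hT : F.Tangent i
  · have hzi : |z i| ≤ 2 * (1 - s) := by
      have h1 := norm_le_pi_norm (tangentPart F.Tangent z) i
      simp only [tangentPart, hT, if_true, Real.norm_eq_abs] at h1
      linarith
    set o : ℤ := if 0 ≤ z i then 1 else -1 with ho
    set d : ℤ := if (1 - s) * o ≤ z i then 1 else -1 with hd
    have hθ : |z i - (1 - s) * o| ≤ 1 - s := by
      rw [abs_le] at hzi ⊢
      rw [ho]
      split_ifs with h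
      · push_cast
        constructor <;> linarith
      · push_cast
        push Not at h
        constructor <;> linarith
    have hdθ : d * |z i - (1 - s) * o| = z i - (1 - s) * o := by
      rw [hd]
      split_ifs with h
      · rw [abs_of_nonneg (by linarith)]
        simp
      · rw [abs_of_nonpos (by linarith)]
        simp
    rw [setIntegral_step (a := 0) (b := o) (c := d) (s := 1 - s) (t := |z i - (1 - s) * o|)
      ⟨by linarith, by linarith⟩ ⟨abs_nonneg _, by linarith⟩, hdθ]
    · ring
    · intro t ht
      by_cases h : t < 1 - s
      · simp only [h, if_true, Cell.displ_fine, finePath, hT, ← ho, ← hd]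
        split_ifs <;> simp
      · have h1 : ¬ t < |z i - (1 - s) * o| := fun h1 => h (h1.trans_le hθ)
        simp only [h, h1, if_false,
          displ_coarse_eq_zero hT (coarse_coarsePath_mem_disk ht.2 (not_lt.1 h))]
        simp
  · by_cases hS : F.Side i
    · have h1 := sheetDepth_le_wallDist hT hS z
      have h2 := sheetDepth_nonneg (B := F.Side) z
      have h3 := hu i
      rw [setIntegral_step (a := -1) (b := -1) (c := 2)
        (s := 1 - wallDist F.Tangent F.Side z i) (t := 1 - sheetDepth F.Side z)
        ⟨by linarith, by linarith⟩ ⟨by linarith, by linarith⟩]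
      · simp only [wallDist, hT, hS, if_true, if_false]
        ring
      · intro t ht
        by_cases h : t < 1 - s
        · rw [if_pos h, if_pos (by linarith), if_pos (by linarith),
            displ_finePath_of_not_tangent hT]
          norm_num
        · rw [if_neg h]
          exact displ_coarsePath_of_side ht.2 hS
    · have h3 := hu i
      simp only [wallDist, hT, hS, if_false] at h3
      rw [setIntegral_step (a := if 0 ≤ z i then 1 else -1) (b := -(if 0 ≤ z i then 1 else -1))
        (c := 0) (s := 1 - |z i|) (t := 0)
        ⟨by linarith, by linarith [abs_nonneg (z i)]⟩ ⟨le_rfl, zero_le_one⟩]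
      · split_ifs with h
        · rw [abs_of_nonneg h]
          ring
        · rw [abs_of_neg (not_le.1 h)]
          ring
      · intro t ht
        by_cases h : t < 1 - s
        · rw [if_pos h, displ_finePath_of_not_tangent hT, if_pos (h.trans_le (by linarith))]
          push_cast
          ring
        · rw [if_neg h, displ_coarsePath_of_not_side hT hS]
          ring

/-- The disk starred at a cell is a triangulated disk. -/
lemma isTriangulatedDisk_disk (hm : 0 < m) (F : Cell n m) :
    SComplex.IsTriangulatedDisk (SComplex.orderC (disk F)) (SComplex.orderC (diskBdry F)) n := by
  have hsub : (SComplex.orderC (diskBdry F)).IsSubcomplex (SComplex.orderC (disk F)) :=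
    fun σ hσ => ⟨hσ.1, hσ.2.1.trans (diskBdry_subset_disk F), hσ.2.2⟩
  refine SComplex.isTriangulatedDisk_of_bijOn hsub
    (fun v i => (F.displ v i : ℝ)) (G := cellGauge F.Tangent F.Side) continuous_cellGauge
    cellGauge_add cellGauge_smul norm_le_two_mul_cellGauge ⟨fun x hx => ?_, fun x hx y hy h => ?_,
      fun z hz => ?_⟩ fun x hx => ?_
  · exact cellGauge_place_le_one hx
  · exact eq_of_place_eq hx hy h
  · exact exists_place_eq hm hz
  · exact mem_bdry_iff_cellGauge_place hx

lemma displ_mem_Icc {v : Vtx n m} (hv : v ∈ disk F) (i : Fin n) :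
    F.displ v i ∈ Finset.Icc (-2 : ℤ) 2 := by
  rw [Finset.mem_Icc]
  rcases v with c | Q
  · have h := (fine_mem_disk_iff.1 hv).1 i
    rw [abs_le] at h
    rw [Cell.displ_fine]
    omega
  · have h := (coarse_mem_disk_iff.1 hv).1 i
    have h1 : |Q.coord i - F.coord i| ≤ 1 := by
      rw [abs_le]
      unfold LineLe at h
      omega
    have h2 := abs_nonneg (Q.coord i - F.coord i)
    have h3 := abs_le.1 h1
    rw [Cell.displ_coarse]
    split_ifs <;> omega

lemma injOn_displ : Set.InjOn F.displ (disk F) := by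
  have hmem : ∀ v ∈ disk F, Pi.single v (1 : ℝ) ∈ (SComplex.orderC (disk F)).realization := by
    intro v hv
    have hsupp : ∀ w, (Pi.single v (1 : ℝ) : Vtx n m → ℝ) w ≠ 0 → w = v := fun w hw => by
      by_contra hne
      exact hw (Pi.single_eq_of_ne hne 1)
    rw [SComplex.mem_realization_orderC]
    refine ⟨fun w => ?_, fun w hw => hsupp w hw ▸ hv, fun a ha b hb hab => ?_, ?_⟩
    · by_cases h : w = v
      · subst h
        simp
      · simp [h]
    · exact absurd ((hsupp a ha).trans (hsupp b hb).symm) hab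
    · exact Fintype.sum_pi_single' v 1
  have hplace : ∀ v i, F.place (Pi.single v (1 : ℝ)) i = F.displ v i := by
    intro v i
    simp [Cell.place, wsum, Pi.single_apply]
  intro v hv w hw h
  have := eq_of_place_eq (hmem v hv) (hmem w hw) (funext fun i => by rw [hplace, hplace, h])
  by_contra hne
  have h1 := congrFun this v
  rw [Pi.single_eq_same, Pi.single_eq_of_ne hne] at h1
  exact one_ne_zero h1

lemma ncard_disk_le (F : Cell n m) : ((disk F).ncard : ℤ) ≤ 6 ^ n := by
  have h : (disk F).ncard ≤ (Fintype.piFinset fun _ : Fin n => Finset.Icc (-2 : ℤ) 2).card := by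
    rw [← Set.ncard_coe_finset]
    exact Set.ncard_le_ncard_of_injOn F.displ
      (fun v hv => Finset.mem_coe.2 (Fintype.mem_piFinset.2 fun i => displ_mem_Icc hv i))
      injOn_displ (Finset.finite_toSet _)
  rw [Fintype.card_piFinset_const] at h
  have h' : (Finset.Icc (-2 : ℤ) 2).card = 5 := rfl
  rw [h'] at h
  calc ((disk F).ncard : ℤ) ≤ 5 ^ n := by exact_mod_cast h
    _ ≤ 6 ^ n := pow_le_pow_left₀ (by norm_num) (by norm_num) n

end Vtx

/-- For `n ≥ 1` and `k ≥ 0`, the triangulation `L_{k+1}` of `Sⁿ`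
`6^n`-stars to `L_k`: some complex isomorphic to `L_{k+1}` is transformed by a finite
sequence of `6^n`-starrings into a complex isomorphic to `L_k`. -/
theorem sphereGrid_starsTo (n : ℕ) (hn : 1 ≤ n) (k : ℕ) :
    ∃ (A : Type) (X Y : SComplex A),
      SComplex.Iso X (sphereGrid n (k + 1)) ∧
      SComplex.StarsTo ((6 : ℤ) ^ n) X Y ∧
      SComplex.Iso Y (sphereGrid n k) := by
  refine ⟨Vtx n (2 ^ k), SComplex.orderC (Vtx.stage ∅), SComplex.orderC (Vtx.stage Set.univ),
    ?_, ?_, ?_⟩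
  · rw [Vtx.stage_empty]
    exact Cell.iso_orderC_range (by ring) _
  · exact Vtx.starsTo_stage Vtx.ncard_disk_le
      (Vtx.isTriangulatedDisk_disk (by positivity)) _ isUpperSet_univ
  · rw [Vtx.stage_univ]
    exact Cell.iso_orderC_range rfl _
end
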